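/- arXiv:math/0101178 — 4 statements merged into one kernel-verified Lean document; each statement's English description precedes it below -/
import Mathlib

section
/- For every finitely supported sequence f : ℕ → ℂ and every ρ ∈ [0, 2π/h], the spherical transform diagonalizes Δ: (Δf)^(ρ) = λ(ρ)·f̂(ρ), where λ(ρ) = −(1−q^{1+2iρ})(1−q^{1−2iρ})/(1−q²)² and f̂(ρ) = (1−q²) Σ_{m≥0} φ_ρ(q^{2m}) f(q^{2m}) q^{-2m}. -/
open scoped BigOperators
open Complex

noncomputable section

/-- `q^w = exp(w · ln q)` for real `q > 0` and complex `w`. -/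
noncomputable def qpow (q : ℝ) (w : ℂ) : ℂ := Complex.exp (w * (Real.log q : ℂ))

/-- The finite q-Pochhammer symbol `(a;Q)_n = ∏_{j=0}^{n-1} (1 − a Q^j)`. -/
noncomputable def qPoch (a Q : ℂ) (n : ℕ) : ℂ := ∏ j ∈ Finset.range n, (1 - a * Q ^ j)

/-- The infinite q-Pochhammer symbol `(a;Q)_∞ = ∏_{j=0}^{∞} (1 − a Q^j)`. -/
noncomputable def qPochInf (a Q : ℂ) : ℂ := ∏' j : ℕ, (1 - a * Q ^ j)

/-- The eigenvalue `λ(ρ) = −(1−q^{1+2iρ})(1−q^{1−2iρ})/(1−q²)²`. -/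
noncomputable def lambdaQ (q : ℝ) (ρ : ℂ) : ℂ :=
  -((1 - qpow q (1 + 2 * I * ρ)) * (1 - qpow q (1 - 2 * I * ρ))) / (1 - (q : ℂ) ^ 2) ^ 2

/-- The general term of the series defining the Jost-type solution `ψ_ρ(q^{2m})`. -/
noncomputable def psiTerm (q : ℝ) (ρ : ℂ) (m k : ℕ) : ℂ :=
  (qPoch (qpow q (1 - 2 * I * ρ)) ((q : ℂ) ^ 2) k) ^ 2 * (q : ℂ) ^ (2 * k) *
      (q : ℂ) ^ (2 * k * m) /
    (qPoch (qpow q (2 - 4 * I * ρ)) ((q : ℂ) ^ 2) k * qPoch ((q : ℂ) ^ 2) ((q : ℂ) ^ 2) k)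

/-- The Jost-type solution
`ψ_ρ(q^{2m}) = q^{(1−2iρ)m} Σ_{k≥0} ((q^{1−2iρ};q²)_k)² q^{2k} q^{2km} / ((q^{2−4iρ};q²)_k (q²;q²)_k)`. -/
noncomputable def psiQ (q : ℝ) (ρ : ℂ) (m : ℕ) : ℂ :=
  qpow q ((1 - 2 * I * ρ) * (m : ℂ)) * ∑' k : ℕ, psiTerm q ρ m k

/-- The q-spherical function
`φ_ρ(q^{2m}) = Σ_{k=0}^{m} (q^{-2m};q²)_k (q^{1+2iρ};q²)_k (q^{1−2iρ};q²)_k q^{2k} / ((q²;q²)_k)²`. -/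
noncomputable def phiQ (q : ℝ) (ρ : ℂ) (m : ℕ) : ℂ :=
  ∑ k ∈ Finset.range (m + 1),
    qPoch ((q : ℂ) ^ (-(2 * (m : ℤ)))) ((q : ℂ) ^ 2) k *
        qPoch (qpow q (1 + 2 * I * ρ)) ((q : ℂ) ^ 2) k *
        qPoch (qpow q (1 - 2 * I * ρ)) ((q : ℂ) ^ 2) k * (q : ℂ) ^ (2 * k) /
      (qPoch ((q : ℂ) ^ 2) ((q : ℂ) ^ 2) k) ^ 2

/-- The radial part of the q-invariant Laplacian, acting on sequences `f : ℕ → ℂ` (where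
`f m` stands for `f(q^{2m})`); for `m = 0` the first bracketed term (carrying the factor
`1−q⁰ = 0`) is set equal to `0`. -/
noncomputable def DeltaQ (q : ℝ) (f : ℕ → ℂ) : ℕ → ℂ := fun m =>
  (q : ℂ) ^ (-1 : ℤ) * (q : ℂ) ^ (4 * (m : ℤ)) *
    ((if m = 0 then 0 else
        (1 - (q : ℂ) ^ (2 * (m : ℤ))) * (f (m - 1) - f m) /
          ((q : ℂ) ^ (2 * (m : ℤ) - 2) - (q : ℂ) ^ (2 * (m : ℤ)))) -
      (1 - (q : ℂ) ^ (2 * (m : ℤ) + 2)) * (f m - f (m + 1)) /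
        ((q : ℂ) ^ (2 * (m : ℤ)) - (q : ℂ) ^ (2 * (m : ℤ) + 2))) /
    ((q : ℂ) ^ (2 * (m : ℤ) - 1) - (q : ℂ) ^ (2 * (m : ℤ) + 1))

/-- `h = ln(q^{-2})`. -/
noncomputable def hQ (q : ℝ) : ℝ := Real.log (q ^ (-2 : ℤ))

/-- The spherical transform `f̂(ρ) = (1−q²) Σ_{m≥0} φ_ρ(q^{2m}) f(q^{2m}) q^{-2m}`. -/
noncomputable def sphTransform (q : ℝ) (f : ℕ → ℂ) (ρ : ℝ) : ℂ :=
  (1 - (q : ℂ) ^ 2) * ∑' m : ℕ, phiQ q (ρ : ℂ) m * f m * (q : ℂ) ^ (-(2 * (m : ℤ)))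

theorem qPoch_succ (a Q : ℂ) (n : ℕ) : qPoch a Q (n + 1) = qPoch a Q n * (1 - a * Q ^ n) :=
  Finset.prod_range_succ _ _

theorem qPoch_succ' (a Q : ℂ) (n : ℕ) : qPoch a Q (n + 1) = (1 - a) * qPoch (a * Q) Q n := by
  rw [qPoch, Finset.prod_range_succ', mul_comm, qPoch]
  congr 1
  · simp
  · exact Finset.prod_congr rfl fun j _ => by ring

theorem qPoch_self_ne_zero {Q : ℂ} (hQ : ∀ n : ℕ, 1 - Q ^ (n + 1) ≠ 0) (n : ℕ) :
    qPoch Q Q n ≠ 0 :=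
  Finset.prod_ne_zero_iff.2 fun j _ => by simpa [pow_succ'] using hQ j

theorem qPoch_inv_pow_eq_zero {Q : ℂ} (hQ : Q ≠ 0) {m n : ℕ} (h : m < n) :
    qPoch ((Q ^ m)⁻¹) Q n = 0 :=
  Finset.prod_eq_zero (Finset.mem_range.2 h) (by simp [hQ])

/-- The coefficient of `(q^{-2m};q²)_k` in the series `φ_ρ`, with `Q = q²`. -/
def sphCoeff (A B Q : ℂ) (k : ℕ) : ℂ := qPoch A Q k * qPoch B Q k * Q ^ k / qPoch Q Q k ^ 2

theorem sphCoeff_succ {Q : ℂ} (hQ : ∀ n : ℕ, 1 - Q ^ (n + 1) ≠ 0) (A B : ℂ) (k : ℕ) :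
    sphCoeff A B Q (k + 1) * (1 - Q ^ (k + 1)) ^ 2 =
      sphCoeff A B Q k * ((1 - A * Q ^ k) * (1 - B * Q ^ k) * Q) := by
  have h1 := qPoch_self_ne_zero hQ k
  have h2 := hQ k
  simp only [sphCoeff, qPoch_succ, ← pow_succ' Q k]
  field_simp
  ring

/-- Telescoping form of the second-order difference equation satisfied by the truncations of
the spherical series. -/
theorem sphSeries_telescope {Q A B x : ℂ} (hQ0 : Q ≠ 0) (hQ : ∀ n : ℕ, 1 - Q ^ (n + 1) ≠ 0)
    (hAB : A * B = Q) (hx : x ≠ 0) (N : ℕ) :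
    ∑ k ∈ Finset.range (N + 1), sphCoeff A B Q k *
      (Q * (1 - x⁻¹) * (qPoch (x * Q) Q k - qPoch x Q k) -
        (1 - Q * x⁻¹) * (qPoch x Q k - qPoch (x * Q⁻¹) Q k) +
        (1 - A) * (1 - B) * qPoch x Q k) =
      sphCoeff A B Q N * ((1 - A * Q ^ N) * (1 - B * Q ^ N) * (Q ^ N)⁻¹ * qPoch x Q N) := by
  induction N with
  | zero => simp [qPoch, sphCoeff]
  | succ N ih =>
    rw [Finset.sum_range_succ, ih]
    have hcoeff := sphCoeff_succ hQ A B N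
    have hup : (1 - x) * qPoch (x * Q) Q (N + 1) =
        qPoch x Q N * (1 - x * Q ^ N) * (1 - x * Q ^ (N + 1)) := by
      rw [← qPoch_succ', qPoch_succ, qPoch_succ]
    have hdown : qPoch (x * Q⁻¹) Q (N + 1) = (1 - x * Q⁻¹) * qPoch x Q N := by
      rw [qPoch_succ', inv_mul_cancel_right₀ hQ0]
    have hp := pow_ne_zero N hQ0
    have hup' : (1 - x⁻¹) * qPoch (x * Q) Q (N + 1) =
        -x⁻¹ * (qPoch x Q N * (1 - x * Q ^ N) * (1 - x * Q ^ (N + 1))) := by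
      rw [← hup]
      field_simp
      ring
    have hstep : sphCoeff A B Q N * ((1 - A * Q ^ N) * (1 - B * Q ^ N) * (Q ^ N)⁻¹ * qPoch x Q N) =
        sphCoeff A B Q (N + 1) * (1 - Q ^ (N + 1)) ^ 2 * (Q ^ (N + 1))⁻¹ * qPoch x Q N := by
      rw [hcoeff, pow_succ]
      field_simp
    rw [hstep, hdown, qPoch_succ x Q N, mul_assoc, mul_assoc, ← mul_add]
    congr 1
    rw [show Q * (1 - x⁻¹) * (qPoch (x * Q) Q (N + 1) - qPoch x Q N * (1 - x * Q ^ N)) =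
      Q * ((1 - x⁻¹) * qPoch (x * Q) Q (N + 1)) -
        Q * (1 - x⁻¹) * (qPoch x Q N * (1 - x * Q ^ N)) by ring, hup']
    generalize qPoch x Q N = p
    rw [show (1 - A) * (1 - B) = 1 - A - B + Q by rw [← hAB]; ring,
      show (1 - A * Q ^ (N + 1)) * (1 - B * Q ^ (N + 1)) =
        1 - (A + B) * Q ^ (N + 1) + Q * (Q ^ (N + 1)) ^ 2 by rw [← hAB]; ring,
      pow_succ Q N]
    generalize Q ^ N = y at hp ⊢
    field_simp
    ring

theorem DeltaQ_apply {q : ℝ} (hq : (q : ℂ) ≠ 0) (hq1 : 1 - (q : ℂ) ^ 2 ≠ 0) (f : ℕ → ℂ) (m : ℕ) :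
    DeltaQ q f m = ((q : ℂ) ^ 2 * (1 - ((q : ℂ) ^ 2) ^ m) * (f (m - 1) - f m) -
      (1 - ((q : ℂ) ^ 2) ^ (m + 1)) * (f m - f (m + 1))) / (1 - (q : ℂ) ^ 2) ^ 2 := by
  have hy := pow_ne_zero m (pow_ne_zero 2 hq)
  have e2 : (q : ℂ) ^ (2 * (m : ℤ)) = ((q : ℂ) ^ 2) ^ m := by
    rw [zpow_mul, zpow_natCast]; norm_cast
  have e4 : (q : ℂ) ^ (4 * (m : ℤ)) = (((q : ℂ) ^ 2) ^ m) ^ 2 := by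
    rw [← e2, ← zpow_natCast, ← zpow_mul]; congr 1; push_cast; ring
  have hif : (if m = 0 then 0 else
        (1 - (q : ℂ) ^ (2 * (m : ℤ))) * (f (m - 1) - f m) /
          ((q : ℂ) ^ (2 * (m : ℤ) - 2) - (q : ℂ) ^ (2 * (m : ℤ)))) =
        (1 - (q : ℂ) ^ (2 * (m : ℤ))) * (f (m - 1) - f m) /
          ((q : ℂ) ^ (2 * (m : ℤ) - 2) - (q : ℂ) ^ (2 * (m : ℤ))) := by
    split_ifs with h <;> simp [h]
  have a1 : (q : ℂ) ^ (2 * (m : ℤ) - 2) - (q : ℂ) ^ (2 * (m : ℤ)) =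
      ((q : ℂ) ^ 2) ^ m * (1 - (q : ℂ) ^ 2) / (q : ℂ) ^ 2 := by
    rw [zpow_sub₀ hq, e2, zpow_ofNat]; field_simp
  have a2 : (q : ℂ) ^ (2 * (m : ℤ) + 2) = ((q : ℂ) ^ 2) ^ m * (q : ℂ) ^ 2 := by
    rw [zpow_add₀ hq, e2, zpow_ofNat]
  have a3 : (q : ℂ) ^ (2 * (m : ℤ) - 1) - (q : ℂ) ^ (2 * (m : ℤ) + 1) =
      ((q : ℂ) ^ 2) ^ m * (1 - (q : ℂ) ^ 2) / (q : ℂ) := by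
    rw [zpow_sub₀ hq, zpow_add₀ hq, e2, zpow_one]; field_simp
  rw [DeltaQ, hif, a1, a2, a3, e2, e4, pow_succ _ m, zpow_neg_one]
  generalize ((q : ℂ) ^ 2) ^ m = y at hy ⊢
  rw [show y - y * (q : ℂ) ^ 2 = y * (1 - (q : ℂ) ^ 2) by ring]
  field_simp

theorem phiQ_eq_sum {q : ℝ} (hq : (q : ℂ) ≠ 0) (ρ : ℂ) {m N : ℕ} (h : m < N) :
    phiQ q ρ m = ∑ k ∈ Finset.range N,
      sphCoeff (qpow q (1 + 2 * I * ρ)) (qpow q (1 - 2 * I * ρ)) ((q : ℂ) ^ 2) k *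
        qPoch ((((q : ℂ) ^ 2) ^ m)⁻¹) ((q : ℂ) ^ 2) k := by
  have e : (q : ℂ) ^ (-(2 * (m : ℤ))) = (((q : ℂ) ^ 2) ^ m)⁻¹ := by
    rw [zpow_neg, zpow_mul, zpow_natCast]; norm_cast
  rw [← Finset.sum_subset (Finset.range_subset_range.2 h), phiQ]
  · refine Finset.sum_congr rfl fun k _ => ?_
    rw [e, sphCoeff, pow_mul]
    ring
  · intro k _ hk
    rw [qPoch_inv_pow_eq_zero (pow_ne_zero 2 hq) (by simpa using hk), mul_zero]

/-- The spherical function is an eigenfunction of the radial Laplacian. -/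
theorem DeltaQ_phiQ {q : ℝ} (hq : q ∈ Set.Ioo (0 : ℝ) 1) (ρ : ℂ) (m : ℕ) :
    DeltaQ q (phiQ q ρ) m = lambdaQ q ρ * phiQ q ρ m := by
  have hq0 : (q : ℂ) ≠ 0 := by exact_mod_cast hq.1.ne'
  have hQ : ∀ n : ℕ, 1 - ((q : ℂ) ^ 2) ^ (n + 1) ≠ 0 := fun n => by
    have : (q ^ 2) ^ (n + 1) < 1 :=
      pow_lt_one₀ (by positivity) (pow_lt_one₀ hq.1.le hq.2 two_ne_zero) n.succ_ne_zero
    exact_mod_cast (sub_pos.2 this).ne'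
  have hQ1 : 1 - (q : ℂ) ^ 2 ≠ 0 := by simpa using hQ 0
  have hQ0 := pow_ne_zero 2 hq0
  have hAB : qpow q (1 + 2 * I * ρ) * qpow q (1 - 2 * I * ρ) = (q : ℂ) ^ 2 := by
    rw [qpow, qpow, ← Complex.exp_add, ← add_mul]
    rw [show (1 + 2 * I * ρ + (1 - 2 * I * ρ)) * (Real.log q : ℂ) =
      ((2 : ℕ) : ℂ) * (Real.log q : ℂ) by push_cast; ring]
    rw [Complex.exp_nat_mul, ← Complex.ofReal_exp, Real.exp_log hq.1]
  have key := sphSeries_telescope hQ0 hQ hAB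
    (inv_ne_zero (pow_ne_zero m hQ0)) (m + 1)
  rw [qPoch_inv_pow_eq_zero hQ0 m.lt_succ_self, mul_zero, mul_zero] at key
  have hprev : (1 - ((q : ℂ) ^ 2) ^ m) * phiQ q ρ (m - 1) =
      (1 - ((q : ℂ) ^ 2) ^ m) * ∑ k ∈ Finset.range (m + 1 + 1),
        sphCoeff (qpow q (1 + 2 * I * ρ)) (qpow q (1 - 2 * I * ρ)) ((q : ℂ) ^ 2) k *
          qPoch ((((q : ℂ) ^ 2) ^ m)⁻¹ * (q : ℂ) ^ 2) ((q : ℂ) ^ 2) k := by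
    rcases m with _ | m
    · simp
    · rw [phiQ_eq_sum hq0 ρ (show m + 1 - 1 < m + 1 + 1 + 1 by omega), Nat.add_sub_cancel,
        pow_succ _ m, mul_inv, inv_mul_cancel_right₀ hQ0]
  have hself := phiQ_eq_sum hq0 ρ (show m < m + 1 + 1 by omega)
  have hnext := phiQ_eq_sum hq0 ρ (show m + 1 < m + 1 + 1 by omega)
  rw [pow_succ _ m, mul_inv] at hnext
  simp only [mul_add, mul_sub, Finset.sum_add_distrib, Finset.sum_sub_distrib] at key
  simp only [mul_left_comm (sphCoeff _ _ _ _), ← mul_sub, ← Finset.mul_sum] at key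
  rw [inv_inv, ← hself, ← hnext] at key
  rw [DeltaQ_apply hq0 hQ1, lambdaQ, div_mul_eq_mul_div]
  congr 1
  rw [pow_succ _ m]
  linear_combination key + (q : ℂ) ^ 2 * hprev

/-- Green's identity for the radial Laplacian on an initial segment. -/
theorem sum_range_mul_DeltaQ_sub {q : ℝ} (hq : (q : ℂ) ≠ 0) (hq1 : 1 - (q : ℂ) ^ 2 ≠ 0)
    (f g : ℕ → ℂ) (N : ℕ) :
    ∑ m ∈ Finset.range (N + 1), (g m * DeltaQ q f m - DeltaQ q g m * f m) *
        (((q : ℂ) ^ 2) ^ m)⁻¹ =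
      (1 - ((q : ℂ) ^ 2) ^ (N + 1)) * (g N * f (N + 1) - f N * g (N + 1)) *
        (((q : ℂ) ^ 2) ^ N)⁻¹ / (1 - (q : ℂ) ^ 2) ^ 2 := by
  induction N with
  | zero => simp [DeltaQ_apply hq hq1]; ring
  | succ N ih =>
    rw [Finset.sum_range_succ, ih, DeltaQ_apply hq hq1, DeltaQ_apply hq hq1, Nat.add_sub_cancel]
    simp only [pow_succ _ (N + 1), pow_succ _ N]
    have hp := pow_ne_zero N (pow_ne_zero 2 hq)
    generalize ((q : ℂ) ^ 2) ^ N = y at hp ⊢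
    field_simp
    ring

/-- for finitely supported `f` and `ρ ∈ [0, 2π/h]`, the spherical transform
diagonalizes `Δ`: `(Δf)^(ρ) = λ(ρ)·f̂(ρ)`. -/
theorem sphTransform_diagonalizes_deltaQ (q : ℝ) (hq : q ∈ Set.Ioo (0 : ℝ) 1)
    (f : ℕ → ℂ) (hf : (Function.support f).Finite)
    (ρ : ℝ) (hρ : ρ ∈ Set.Icc (0 : ℝ) (2 * Real.pi / hQ q)) :
    sphTransform q (DeltaQ q f) ρ = lambdaQ q (ρ : ℂ) * sphTransform q f ρ := by
  have hq0 : (q : ℂ) ≠ 0 := by exact_mod_cast hq.1.ne'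
  have hQ1 : 1 - (q : ℂ) ^ 2 ≠ 0 := by
    exact_mod_cast (sub_pos.2 (pow_lt_one₀ hq.1.le hq.2 two_ne_zero)).ne'
  obtain ⟨N, hN⟩ := hf.bddAbove
  have hzero : ∀ m, N < m → f m = 0 := fun m hm => by
    by_contra h
    exact (hN h).not_gt hm
  have hΔ : ∀ m, N + 1 < m → DeltaQ q f m = 0 := fun m hm => by
    rw [DeltaQ_apply hq0 hQ1, hzero (m - 1) (by omega), hzero m (by omega),
      hzero (m + 1) (by omega)]
    simp
  have green := sum_range_mul_DeltaQ_sub hq0 hQ1 f (phiQ q ρ) (N + 1)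
  rw [hzero (N + 1) (by omega), hzero (N + 1 + 1) (by omega)] at green
  have e : ∀ m : ℕ, (q : ℂ) ^ (-(2 * (m : ℤ))) = (((q : ℂ) ^ 2) ^ m)⁻¹ := fun m => by
    rw [zpow_neg, zpow_mul, zpow_natCast]; norm_cast
  simp only [sphTransform, e]
  rw [tsum_eq_sum (s := Finset.range (N + 1 + 1)) fun m hm => by
      rw [hΔ m (by simpa using hm)]; simp,
    tsum_eq_sum (s := Finset.range (N + 1 + 1)) fun m hm => by
      rw [hzero m (by have := Finset.mem_range.not.1 hm; omega)]; simp,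
    mul_left_comm]
  congr 1
  rw [Finset.mul_sum, ← sub_eq_zero, ← Finset.sum_sub_distrib]
  convert green using 1
  · refine Finset.sum_congr rfl fun m _ => ?_
    rw [DeltaQ_phiQ hq]
    ring
  · simp

end
end

section
/- The sequence g₁ defined by g₁(q^{2N}) = −(1−q²) Σ_{m=1}^{∞} [(q^{-2}−1)/(q^{-2m}−1)] q^{2Nm} (N ∈ ℕ) belongs to L²(dν)q⁰ and satisfies Δ g₁ = f₀; that is, Δ^{-1} f₀ = g₁. -/
open scoped BigOperators

noncomputable section

/-- The q-analogue `f₀` of the delta-function at the centre of the disc: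
`f₀(q⁰) = 1` and `f₀(q^{2k}) = 0` for `k ≥ 1`. -/
noncomputable def fZero : ℕ → ℂ := fun N => if N = 0 then 1 else 0

/-- `g₁(q^{2N}) = −(1−q²) Σ_{m=1}^{∞} [(q^{-2}−1)/(q^{-2m}−1)] q^{2Nm}`
(the sum over `m ≥ 1` is written as a sum over `m : ℕ` via `m ↦ m+1`). -/
noncomputable def gOne (q : ℝ) (N : ℕ) : ℂ :=
  -(1 - (q : ℂ) ^ 2) *
    ∑' m : ℕ, ((q : ℂ) ^ (-2 : ℤ) - 1) / ((q : ℂ) ^ (-(2 * ((m : ℤ) + 1))) - 1) *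
      (q : ℂ) ^ (2 * N * (m + 1))

/-- The real form of the `m`-th summand of `gOne q N`, written in terms of `p = q ^ 2`. -/
def gOneTerm (p : ℝ) (N m : ℕ) : ℝ :=
  (1 - p) * p ^ m / (1 - p ^ (m + 1)) * p ^ (N * (m + 1))

lemma gOneTerm_nonneg {p : ℝ} (h0 : 0 < p) (h1 : p < 1) (N m : ℕ) : 0 ≤ gOneTerm p N m := by
  have h2 : 0 < 1 - p ^ (m + 1) := sub_pos.2 (pow_lt_one₀ h0.le h1 (Nat.succ_ne_zero m))
  have h3 : 0 < 1 - p := sub_pos.2 h1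
  unfold gOneTerm
  positivity

lemma gOneTerm_le {p : ℝ} (h0 : 0 < p) (h1 : p < 1) (N m : ℕ) :
    gOneTerm p N m ≤ p ^ m * p ^ N := by
  have h2 : 0 < 1 - p ^ (m + 1) := sub_pos.2 (pow_lt_one₀ h0.le h1 (Nat.succ_ne_zero m))
  have h4 : p ^ (m + 1) ≤ p := pow_le_of_le_one h0.le h1.le (Nat.succ_ne_zero m)
  unfold gOneTerm
  refine mul_le_mul ?_ ?_ (by positivity) (by positivity)
  · rw [div_le_iff₀ h2, mul_comm]
    gcongr
  · exact pow_le_pow_of_le_one h0.le h1.le (Nat.le_mul_of_pos_right N m.succ_pos)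

lemma summable_gOneTerm {p : ℝ} (h0 : 0 < p) (h1 : p < 1) (N : ℕ) :
    Summable (gOneTerm p N) :=
  ((summable_geometric_of_lt_one h0.le h1).mul_right _).of_nonneg_of_le
    (gOneTerm_nonneg h0 h1 N) (gOneTerm_le h0 h1 N)

lemma tsum_gOneTerm_le {p : ℝ} (h0 : 0 < p) (h1 : p < 1) (N : ℕ) :
    (1 - p) * ∑' m, gOneTerm p N m ≤ p ^ N := by
  have h3 : 0 < 1 - p := sub_pos.2 h1
  have hs := summable_geometric_of_lt_one h0.le h1
  have h := (summable_gOneTerm h0 h1 N).tsum_le_tsum (gOneTerm_le h0 h1 N) (hs.mul_right _)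
  rw [tsum_mul_right, tsum_geometric_of_lt_one h0.le h1] at h
  calc (1 - p) * ∑' m, gOneTerm p N m ≤ (1 - p) * ((1 - p)⁻¹ * p ^ N) := by gcongr
    _ = p ^ N := by field_simp

lemma tsum_gOneTerm_sub {p : ℝ} (h0 : 0 < p) (h1 : p < 1) (N : ℕ) :
    ∑' m, gOneTerm p N m - ∑' m, gOneTerm p (N + 1) m =
      (1 - p) * p ^ N / (1 - p ^ (N + 1)) := by
  rw [← (summable_gOneTerm h0 h1 N).tsum_sub (summable_gOneTerm h0 h1 (N + 1))]
  have h (m : ℕ) : gOneTerm p N m - gOneTerm p (N + 1) m =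
      (1 - p) * p ^ N * (p ^ (N + 1)) ^ m := by
    have h2 : 1 - p ^ (m + 1) ≠ 0 :=
      (sub_pos.2 (pow_lt_one₀ h0.le h1 (Nat.succ_ne_zero m))).ne'
    unfold gOneTerm
    calc _ = (1 - p) * p ^ m * p ^ (N * (m + 1)) * ((1 - p ^ (m + 1)) / (1 - p ^ (m + 1))) := by
          ring
      _ = _ := by rw [div_self h2]; ring
  simp_rw [h]
  rw [tsum_mul_left, tsum_geometric_of_lt_one (by positivity)
    (pow_lt_one₀ h0.le h1 (Nat.succ_ne_zero N)), div_eq_mul_inv]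

lemma gOne_eq_ofReal {q : ℝ} (h0 : 0 < q) (h1 : q < 1) (N : ℕ) :
    gOne q N = ((-(1 - q ^ 2) * ∑' m, gOneTerm (q ^ 2) N m : ℝ) : ℂ) := by
  unfold gOne
  push_cast
  congr 2
  ext m
  have hm : (1 : ℝ) - (q ^ 2) ^ (m + 1) ≠ 0 :=
    (sub_pos.2 (pow_lt_one₀ (by positivity) (pow_lt_one₀ h0.le h1 two_ne_zero)
      (Nat.succ_ne_zero m))).ne'
  have key : (q ^ (-2 : ℤ) - 1) / (q ^ (-(2 * ((m : ℤ) + 1))) - 1) * q ^ (2 * N * (m + 1)) =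
      gOneTerm (q ^ 2) N m := by
    have e1 : q ^ (-2 : ℤ) = (q ^ 2)⁻¹ := by rw [zpow_neg]; norm_cast
    have e2 : q ^ (-(2 * ((m : ℤ) + 1))) = ((q ^ 2) ^ (m + 1))⁻¹ := by
      rw [zpow_neg, ← pow_mul]; norm_cast
    have e3 : ((q ^ 2) ^ (m + 1))⁻¹ - 1 = (1 - (q ^ 2) ^ (m + 1)) / (q ^ 2) ^ (m + 1) := by
      field_simp
    rw [e1, e2, e3, gOneTerm, mul_assoc 2 N, pow_mul q 2]
    field_simp
    ring
  rw [← key]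
  push_cast
  rfl

lemma norm_gOne_le {q : ℝ} (h0 : 0 < q) (h1 : q < 1) (N : ℕ) : ‖gOne q N‖ ≤ (q ^ 2) ^ N := by
  have hp0 : 0 < q ^ 2 := by positivity
  have hp1 : q ^ 2 < 1 := pow_lt_one₀ h0.le h1 two_ne_zero
  rw [gOne_eq_ofReal h0 h1, Complex.norm_real, neg_mul, norm_neg, Real.norm_of_nonneg
    (mul_nonneg (sub_pos.2 hp1).le (tsum_nonneg (gOneTerm_nonneg hp0 hp1 N)))]
  exact tsum_gOneTerm_le hp0 hp1 N

/-- The flux `(1 - q^{2N+2}) (g₁(q^{2N}) - g₁(q^{2N+2})) / (q^{2N} - q^{2N+2})` is constant. -/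
lemma gOne_flux {q : ℝ} (h0 : 0 < q) (h1 : q < 1) (N : ℕ) :
    (1 - (q : ℂ) ^ (2 * (N : ℤ) + 2)) * (gOne q N - gOne q (N + 1)) /
      ((q : ℂ) ^ (2 * (N : ℤ)) - (q : ℂ) ^ (2 * (N : ℤ) + 2)) = -(1 - (q : ℂ) ^ 2) := by
  have hp0 : 0 < q ^ 2 := by positivity
  have hp1 : q ^ 2 < 1 := pow_lt_one₀ h0.le h1 two_ne_zero
  have h2 : 1 - (q ^ 2) ^ (N + 1) ≠ 0 :=
    (sub_pos.2 (pow_lt_one₀ hp0.le hp1 (Nat.succ_ne_zero N))).ne'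
  have h3 : 1 - q ^ 2 ≠ 0 := (sub_pos.2 hp1).ne'
  have e1 : q ^ (2 * (N : ℤ) + 2) = (q ^ 2) ^ (N + 1) := by rw [← pow_mul]; norm_cast
  have e2 : q ^ (2 * (N : ℤ)) = (q ^ 2) ^ N := by rw [← pow_mul]; norm_cast
  have key : (1 - q ^ (2 * (N : ℤ) + 2)) *
      (-(1 - q ^ 2) * ∑' m, gOneTerm (q ^ 2) N m -
        -(1 - q ^ 2) * ∑' m, gOneTerm (q ^ 2) (N + 1) m) /
      (q ^ (2 * (N : ℤ)) - q ^ (2 * (N : ℤ) + 2)) = -(1 - q ^ 2) := by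
    have e3 : (q ^ 2) ^ N - (q ^ 2) ^ (N + 1) = (1 - q ^ 2) * (q ^ 2) ^ N := by ring
    rw [← mul_sub, tsum_gOneTerm_sub hp0 hp1, e1, e2, e3]
    field_simp
  rw [gOne_eq_ofReal h0 h1, gOne_eq_ofReal h0 h1]
  exact_mod_cast congrArg (fun x : ℝ => (x : ℂ)) key

/-- `g₁` belongs to `L²(dν)q⁰` and satisfies `Δ g₁ = f₀`, i.e. `Δ⁻¹ f₀ = g₁`. -/
theorem deltaQ_inv_fZero (q : ℝ) (hq : q ∈ Set.Ioo (0 : ℝ) 1) :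
    Summable (fun N : ℕ => ‖gOne q N‖ ^ 2 * q ^ (-(2 * (N : ℤ)))) ∧
    (∀ N : ℕ, DeltaQ q (gOne q) N = fZero N) := by
  obtain ⟨h0, h1⟩ := hq
  have hp1 : q ^ 2 < 1 := pow_lt_one₀ h0.le h1 two_ne_zero
  refine ⟨?_, fun N => ?_⟩
  · refine (summable_geometric_of_lt_one (sq_nonneg q) hp1).of_nonneg_of_le
      (fun N => by positivity) fun N => ?_
    have e : q ^ (-(2 * (N : ℤ))) = ((q ^ 2) ^ N)⁻¹ := by
      rw [zpow_neg, ← pow_mul]; norm_cast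
    rw [e]
    calc ‖gOne q N‖ ^ 2 * ((q ^ 2) ^ N)⁻¹ ≤ ((q ^ 2) ^ N) ^ 2 * ((q ^ 2) ^ N)⁻¹ := by
          gcongr
          exact norm_gOne_le h0 h1 N
      _ = (q ^ 2) ^ N := by field_simp
  · unfold DeltaQ fZero
    rw [gOne_flux h0 h1]
    rcases N with _ | n
    · have hq0 : (q : ℂ) ≠ 0 := by exact_mod_cast h0.ne'
      have hq1 : 1 - (q : ℂ) ^ 2 ≠ 0 := by exact_mod_cast (sub_pos.2 hp1).ne'
      have e : (q : ℂ)⁻¹ - q = (1 - (q : ℂ) ^ 2) / q := by field_simp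
      simp [e]
      field_simp
    · have h := gOne_flux h0 h1 n
      have e1 : 2 * ((n + 1 : ℕ) : ℤ) = 2 * (n : ℤ) + 2 := by push_cast; ring
      have e2 : 2 * (n : ℤ) + 2 - 2 = 2 * (n : ℤ) := by ring
      rw [if_neg n.succ_ne_zero, if_neg n.succ_ne_zero, e1, e2, Nat.add_sub_cancel, h]
      simp

end
end

section
/- The sequence g₂ defined by g₂(q^{2N}) = (1−q²)·( Σ_{m=1}^{∞} [q^{2m-2}(1+q^{2m})(1−q²)²/(1−q^{2m})²] q^{2Nm} + N(1−q²) Σ_{m=1}^{∞} [(q^{-2}−1)/(q^{-2m}−1)] q^{2Nm} ) (N ∈ ℕ) belongs to L²(dν)q⁰ and satisfies Δ(Δ g₂) = f₀; that is, Δ^{-2} f₀ = g₂. (In the variable y = q^{2N} the second term reads −((1−q²)/h)·ln y · Σ_{m≥1} [(q^{-2}−1)/(q^{-2m}−1)] y^m with h = ln(q^{-2}); g₂ is a q-analogue of Rogers' dilogarithm.) -/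
open scoped BigOperators

noncomputable section

/-- `g₂(q^{2N}) = (1−q²)·( Σ_{m=1}^{∞} [q^{2m-2}(1+q^{2m})(1−q²)²/(1−q^{2m})²] q^{2Nm}`
`+ N(1−q²) Σ_{m=1}^{∞} [(q^{-2}−1)/(q^{-2m}−1)] q^{2Nm} )`, a q-analogue of Rogers'
dilogarithm (sums over `m ≥ 1` are written as sums over `m : ℕ` via `m ↦ m+1`). -/
noncomputable def gTwo (q : ℝ) (N : ℕ) : ℂ :=
  (1 - (q : ℂ) ^ 2) *
    ((∑' m : ℕ, (q : ℂ) ^ (2 * (m + 1) - 2) * (1 + (q : ℂ) ^ (2 * (m + 1))) *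
        (1 - (q : ℂ) ^ 2) ^ 2 / (1 - (q : ℂ) ^ (2 * (m + 1))) ^ 2 *
        (q : ℂ) ^ (2 * N * (m + 1))) +
      (N : ℂ) * (1 - (q : ℂ) ^ 2) *
        ∑' m : ℕ, ((q : ℂ) ^ (-2 : ℤ) - 1) / ((q : ℂ) ^ (-(2 * ((m : ℤ) + 1))) - 1) *
          (q : ℂ) ^ (2 * N * (m + 1)))

/-- The power series `∑ m ≥ 1, c_m a^(m-1) y^m` at `y = a^N`, where `c_m` is written `c (m - 1)`. -/
def weightedSeries (a : ℂ) (c : ℕ → ℂ) (N : ℕ) : ℂ :=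
  ∑' m : ℕ, c m * a ^ m * a ^ (N * (m + 1))

section WeightedSeries

variable {a : ℂ} {c : ℕ → ℂ} {C : ℝ}

lemma norm_weightedSeries_term_le (ha : ‖a‖ < 1) (hc : ∀ m, ‖c m‖ ≤ C) (N m : ℕ) :
    ‖c m * a ^ m * a ^ (N * (m + 1))‖ ≤ C * ‖a‖ ^ N * ‖a‖ ^ m := by
  have hC : 0 ≤ C := (norm_nonneg _).trans (hc 0)
  have h : ‖a‖ ^ (N * (m + 1)) ≤ ‖a‖ ^ N :=
    pow_le_pow_of_le_one (norm_nonneg _) ha.le (Nat.le_mul_of_pos_right _ m.succ_pos)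
  rw [norm_mul, norm_mul, norm_pow, norm_pow]
  calc ‖c m‖ * ‖a‖ ^ m * ‖a‖ ^ (N * (m + 1)) ≤ C * ‖a‖ ^ m * ‖a‖ ^ N := by
        gcongr
        exact hc m
    _ = C * ‖a‖ ^ N * ‖a‖ ^ m := by ring

lemma summable_weightedSeries (ha : ‖a‖ < 1) (hc : ∀ m, ‖c m‖ ≤ C) (N : ℕ) :
    Summable fun m : ℕ => c m * a ^ m * a ^ (N * (m + 1)) :=
  .of_norm_bounded ((summable_geometric_of_lt_one (norm_nonneg _) ha).mul_left _)
    (norm_weightedSeries_term_le ha hc N)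

lemma norm_weightedSeries_le (ha : ‖a‖ < 1) (hc : ∀ m, ‖c m‖ ≤ C) (N : ℕ) :
    ‖weightedSeries a c N‖ ≤ C * ‖a‖ ^ N * (1 - ‖a‖)⁻¹ :=
  tsum_of_norm_bounded ((hasSum_geometric_of_lt_one (norm_nonneg _) ha).mul_left _)
    (norm_weightedSeries_term_le ha hc N)

end WeightedSeries

lemma one_sub_pow_succ_ne_zero {a : ℂ} (ha : ‖a‖ < 1) (m : ℕ) : 1 - a ^ (m + 1) ≠ 0 := by
  intro h
  have h1 : ‖a‖ ^ (m + 1) = 1 := by rw [← norm_pow, ← sub_eq_zero.mp h, norm_one]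
  exact (pow_lt_one₀ (norm_nonneg _) ha m.succ_ne_zero).ne h1

lemma one_sub_norm_le_norm_one_sub_pow_succ {a : ℂ} (ha : ‖a‖ < 1) (m : ℕ) :
    1 - ‖a‖ ≤ ‖1 - a ^ (m + 1)‖ := by
  have h1 := norm_sub_norm_le 1 (a ^ (m + 1))
  have h2 : ‖a ^ (m + 1)‖ ≤ ‖a‖ := by
    rw [norm_pow]
    exact pow_le_of_le_one (norm_nonneg _) ha.le m.succ_ne_zero
  rw [norm_one] at h1
  linarith

/-- The coefficients of the logarithm-like Lambert series in `gTwo`. -/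
def lambertCoeff (a : ℂ) (m : ℕ) : ℂ := (1 - a ^ (m + 1))⁻¹

/-- The coefficients of the dilogarithm-like Lambert series in `gTwo`. -/
def dilogCoeff (a : ℂ) (m : ℕ) : ℂ := (1 + a ^ (m + 1)) / (1 - a ^ (m + 1)) ^ 2

lemma norm_lambertCoeff_le {a : ℂ} (ha : ‖a‖ < 1) (m : ℕ) :
    ‖lambertCoeff a m‖ ≤ (1 - ‖a‖)⁻¹ := by
  rw [lambertCoeff, norm_inv]
  exact inv_anti₀ (sub_pos.mpr ha) (one_sub_norm_le_norm_one_sub_pow_succ ha m)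

lemma norm_dilogCoeff_le {a : ℂ} (ha : ‖a‖ < 1) (m : ℕ) :
    ‖dilogCoeff a m‖ ≤ 2 / (1 - ‖a‖) ^ 2 := by
  have h0 : 0 < 1 - ‖a‖ := sub_pos.mpr ha
  have h1 : ‖1 + a ^ (m + 1)‖ ≤ 2 := by
    refine (norm_add_le _ _).trans ?_
    rw [norm_one, norm_pow]
    linarith [pow_le_one₀ (norm_nonneg a) ha.le (n := m + 1)]
  rw [dilogCoeff, norm_div, norm_pow]
  gcongr
  exact one_sub_norm_le_norm_one_sub_pow_succ ha m

lemma weightedSeries_one {a : ℂ} (ha : ‖a‖ < 1) (N : ℕ) :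
    HasSum (fun m : ℕ => a ^ m * a ^ (N * (m + 1))) (a ^ N / (1 - a ^ (N + 1))) := by
  have h : ‖a ^ (N + 1)‖ < 1 := by
    rw [norm_pow]
    exact pow_lt_one₀ (norm_nonneg _) ha N.succ_ne_zero
  rw [div_eq_mul_inv]
  refine ((hasSum_geometric_of_norm_lt_one h).mul_left (a ^ N)).congr_fun ?_
  intro m
  ring

lemma lambert_sub_succ {a : ℂ} (ha : ‖a‖ < 1) (N : ℕ) :
    weightedSeries a (lambertCoeff a) N - weightedSeries a (lambertCoeff a) (N + 1) =
      a ^ N / (1 - a ^ (N + 1)) := by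
  have hs := summable_weightedSeries ha (norm_lambertCoeff_le ha)
  rw [weightedSeries, weightedSeries, ← (hs N).tsum_sub (hs (N + 1)),
    ← (weightedSeries_one ha N).tsum_eq]
  refine tsum_congr fun m => ?_
  have hm := one_sub_pow_succ_ne_zero ha m
  have hx : a ^ ((N + 1) * (m + 1)) = a ^ (N * (m + 1)) * a ^ (m + 1) := by ring
  rw [lambertCoeff, hx]
  generalize a ^ (m + 1) = x at *
  field_simp

/-- The combination of Lambert series which, up to a constant factor, equals `gTwo`. -/
def dilogSeries (a : ℂ) (N : ℕ) : ℂ :=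
  weightedSeries a (dilogCoeff a) N + N * weightedSeries a (lambertCoeff a) N

lemma dilogSeries_sub_succ {a : ℂ} (ha : ‖a‖ < 1) (N : ℕ) :
    dilogSeries a N - dilogSeries a (N + 1) =
      weightedSeries a (lambertCoeff a) N + N * (a ^ N / (1 - a ^ (N + 1))) := by
  have hs := summable_weightedSeries ha (norm_lambertCoeff_le ha)
  have ht := summable_weightedSeries ha (norm_dilogCoeff_le ha)
  have key : weightedSeries a (dilogCoeff a) N - weightedSeries a (dilogCoeff a) (N + 1) =
      weightedSeries a (lambertCoeff a) N + weightedSeries a (lambertCoeff a) (N + 1) := by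
    simp only [weightedSeries]
    rw [← (ht N).tsum_sub (ht (N + 1)), ← (hs N).tsum_add (hs (N + 1))]
    refine tsum_congr fun m => ?_
    have hm := one_sub_pow_succ_ne_zero ha m
    have hx : a ^ ((N + 1) * (m + 1)) = a ^ (N * (m + 1)) * a ^ (m + 1) := by ring
    rw [lambertCoeff, dilogCoeff, hx]
    generalize a ^ (m + 1) = x at *
    field_simp
  have h := lambert_sub_succ ha N
  simp only [dilogSeries]
  push_cast
  linear_combination key + (N : ℂ) * h

lemma gTwo_eq_dilogSeries {q : ℝ} (hq : q ∈ Set.Ioo (0 : ℝ) 1) (ha : ‖(q : ℂ) ^ 2‖ < 1) (N : ℕ) :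
    gTwo q N = (1 - (q : ℂ) ^ 2) ^ 3 * dilogSeries ((q : ℂ) ^ 2) N := by
  have hq0 : (q : ℂ) ≠ 0 := by exact_mod_cast hq.1.ne'
  have h1 : ∀ m : ℕ, (q : ℂ) ^ (2 * (m + 1) - 2) * (1 + (q : ℂ) ^ (2 * (m + 1))) *
        (1 - (q : ℂ) ^ 2) ^ 2 / (1 - (q : ℂ) ^ (2 * (m + 1))) ^ 2 * (q : ℂ) ^ (2 * N * (m + 1)) =
      (1 - (q : ℂ) ^ 2) ^ 2 * (dilogCoeff ((q : ℂ) ^ 2) m * ((q : ℂ) ^ 2) ^ m *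
        ((q : ℂ) ^ 2) ^ (N * (m + 1))) := by
    intro m
    rw [dilogCoeff, show 2 * (m + 1) - 2 = 2 * m by omega, mul_assoc 2 N, pow_mul, pow_mul, pow_mul]
    ring
  have h2 : ∀ m : ℕ, ((q : ℂ) ^ (-2 : ℤ) - 1) / ((q : ℂ) ^ (-(2 * ((m : ℤ) + 1))) - 1) *
        (q : ℂ) ^ (2 * N * (m + 1)) =
      (1 - (q : ℂ) ^ 2) * (lambertCoeff ((q : ℂ) ^ 2) m * ((q : ℂ) ^ 2) ^ m *
        ((q : ℂ) ^ 2) ^ (N * (m + 1))) := by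
    intro m
    have hm := one_sub_pow_succ_ne_zero ha m
    have e1 : (q : ℂ) ^ (-2 : ℤ) = ((q : ℂ) ^ 2)⁻¹ := by
      rw [zpow_neg]; norm_cast
    have e2 : (q : ℂ) ^ (-(2 * ((m : ℤ) + 1))) = (((q : ℂ) ^ 2) ^ (m + 1))⁻¹ := by
      rw [zpow_neg, ← pow_mul]; norm_cast
    have ha0 : (q : ℂ) ^ 2 ≠ 0 := pow_ne_zero _ hq0
    rw [lambertCoeff, mul_assoc 2 N, pow_mul, e1, e2]
    generalize (q : ℂ) ^ 2 = a at *
    have hx : a ^ (m + 1) = a ^ m * a := pow_succ a m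
    have hx0 : a ^ m ≠ 0 := pow_ne_zero _ ha0
    rw [hx] at hm ⊢
    generalize a ^ m = x at *
    have hi : (x * a)⁻¹ - 1 = (1 - x * a) / (x * a) := by field_simp
    rw [hi]
    field_simp
  simp only [gTwo, h1, h2, tsum_mul_left, dilogSeries, weightedSeries]
  ring

lemma DeltaQ_zero {q : ℝ} (hq : q ∈ Set.Ioo (0 : ℝ) 1) (hq1 : 1 - (q : ℂ) ^ 2 ≠ 0) (f : ℕ → ℂ) :
    DeltaQ q f 0 = -(f 0 - f 1) / (1 - (q : ℂ) ^ 2) := by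
  have hq0 : (q : ℂ) ≠ 0 := by exact_mod_cast hq.1.ne'
  have e : (q : ℂ) ^ (2 * ((0 : ℕ) : ℤ) - 1) - (q : ℂ) ^ (2 * ((0 : ℕ) : ℤ) + 1) =
      (1 - (q : ℂ) ^ 2) / q := by
    simp
    field_simp
  have e2 : (q : ℂ) ^ (2 * ((0 : ℕ) : ℤ) + 2) = (q : ℂ) ^ 2 := by norm_cast
  rw [DeltaQ, e, e2]
  simp
  field_simp
  ring

lemma DeltaQ_succ {q : ℝ} (hq : q ∈ Set.Ioo (0 : ℝ) 1) (hq1 : 1 - (q : ℂ) ^ 2 ≠ 0) (f : ℕ → ℂ)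
    (m : ℕ) :
    DeltaQ q f (m + 1) =
      ((q : ℂ) ^ 2 * (1 - ((q : ℂ) ^ 2) ^ (m + 1)) * (f m - f (m + 1)) -
        (1 - ((q : ℂ) ^ 2) ^ (m + 2)) * (f (m + 1) - f (m + 2))) / (1 - (q : ℂ) ^ 2) ^ 2 := by
  have hq0 : (q : ℂ) ≠ 0 := by exact_mod_cast hq.1.ne'
  have hx0 : ((q : ℂ) ^ 2) ^ m ≠ 0 := pow_ne_zero _ (pow_ne_zero _ hq0)
  have e0 : (q : ℂ) ^ (-1 : ℤ) = (q : ℂ)⁻¹ := by simp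
  have e1 : (q : ℂ) ^ (2 * ((m + 1 : ℕ) : ℤ)) = ((q : ℂ) ^ 2) ^ m * (q : ℂ) ^ 2 := by
    rw [← pow_succ, ← pow_mul]; norm_cast
  have e2 : (q : ℂ) ^ (2 * ((m + 1 : ℕ) : ℤ) + 2) = ((q : ℂ) ^ 2) ^ m * (q : ℂ) ^ 4 := by
    rw [zpow_add₀ hq0, e1, mul_assoc]; norm_cast; ring
  have e3 : (q : ℂ) ^ (2 * ((m + 1 : ℕ) : ℤ) - 2) = ((q : ℂ) ^ 2) ^ m := by
    rw [← pow_mul, ← zpow_natCast]; congr 1; push_cast; ring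
  have e4 : (q : ℂ) ^ (2 * ((m + 1 : ℕ) : ℤ) - 1) = ((q : ℂ) ^ 2) ^ m * q := by
    rw [← pow_mul, ← pow_succ, ← zpow_natCast]; congr 1; push_cast; ring
  have e5 : (q : ℂ) ^ (2 * ((m + 1 : ℕ) : ℤ) + 1) = ((q : ℂ) ^ 2) ^ m * (q : ℂ) ^ 3 := by
    rw [← pow_mul, ← pow_add, ← zpow_natCast]; congr 1
  have e6 : (q : ℂ) ^ (4 * ((m + 1 : ℕ) : ℤ)) = (((q : ℂ) ^ 2) ^ m) ^ 2 * (q : ℂ) ^ 4 := by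
    rw [← pow_mul, ← pow_mul, ← pow_add, ← zpow_natCast]; congr 1; push_cast; ring
  have e7 : ((q : ℂ) ^ 2) ^ (m + 1) = ((q : ℂ) ^ 2) ^ m * (q : ℂ) ^ 2 := pow_succ _ _
  have e8 : ((q : ℂ) ^ 2) ^ (m + 2) = ((q : ℂ) ^ 2) ^ m * (q : ℂ) ^ 4 := by ring
  rw [DeltaQ, e0, e1, e2, e3, e4, e5, e6, e7, e8, if_neg m.succ_ne_zero, Nat.add_sub_cancel]
  generalize ((q : ℂ) ^ 2) ^ m = x at *
  have d1 : x - x * (q : ℂ) ^ 2 = x * (1 - (q : ℂ) ^ 2) := by ring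
  have d2 : x * (q : ℂ) ^ 2 - x * (q : ℂ) ^ 4 = x * (q : ℂ) ^ 2 * (1 - (q : ℂ) ^ 2) := by ring
  have d3 : x * (q : ℂ) - x * (q : ℂ) ^ 3 = x * q * (1 - (q : ℂ) ^ 2) := by ring
  rw [d1, d2, d3]
  generalize f m - f (m + 1) = u
  generalize f (m + 1) - f (m + 1 + 1) = v
  field_simp

lemma DeltaQ_gTwo {q : ℝ} (hq : q ∈ Set.Ioo (0 : ℝ) 1) (ha : ‖(q : ℂ) ^ 2‖ < 1) (N : ℕ) :
    DeltaQ q (gTwo q) N =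
      -(1 - (q : ℂ) ^ 2) ^ 2 * weightedSeries ((q : ℂ) ^ 2) (lambertCoeff ((q : ℂ) ^ 2)) N := by
  have hq1 : 1 - (q : ℂ) ^ 2 ≠ 0 := by simpa using one_sub_pow_succ_ne_zero ha 0
  have hd : ∀ N, gTwo q N - gTwo q (N + 1) = (1 - (q : ℂ) ^ 2) ^ 3 *
      (weightedSeries ((q : ℂ) ^ 2) (lambertCoeff ((q : ℂ) ^ 2)) N +
        N * (((q : ℂ) ^ 2) ^ N / (1 - ((q : ℂ) ^ 2) ^ (N + 1)))) := fun N => by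
    rw [gTwo_eq_dilogSeries hq ha, gTwo_eq_dilogSeries hq ha, ← mul_sub, dilogSeries_sub_succ ha]
  cases N with
  | zero =>
    rw [DeltaQ_zero hq hq1, hd 0]
    field_simp
    simp
  | succ m =>
    have hm := one_sub_pow_succ_ne_zero ha m
    have hm' := one_sub_pow_succ_ne_zero ha (m + 1)
    have h := lambert_sub_succ ha m
    rw [DeltaQ_succ hq hq1, hd m, hd (m + 1), sub_eq_iff_eq_add.mp h, div_eq_iff (pow_ne_zero 2 hq1)]
    generalize weightedSeries ((q : ℂ) ^ 2) (lambertCoeff ((q : ℂ) ^ 2)) (m + 1) = S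
    generalize (q : ℂ) ^ 2 = a at *
    push_cast
    field_simp
    ring

lemma DeltaQ_DeltaQ_gTwo {q : ℝ} (hq : q ∈ Set.Ioo (0 : ℝ) 1) (ha : ‖(q : ℂ) ^ 2‖ < 1) (N : ℕ) :
    DeltaQ q (DeltaQ q (gTwo q)) N = fZero N := by
  have hq1 : 1 - (q : ℂ) ^ 2 ≠ 0 := by simpa using one_sub_pow_succ_ne_zero ha 0
  have hd : ∀ N, DeltaQ q (gTwo q) N - DeltaQ q (gTwo q) (N + 1) =
      -(1 - (q : ℂ) ^ 2) ^ 2 * (((q : ℂ) ^ 2) ^ N / (1 - ((q : ℂ) ^ 2) ^ (N + 1))) := fun N => by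
    rw [DeltaQ_gTwo hq ha, DeltaQ_gTwo hq ha, ← mul_sub, lambert_sub_succ ha]
  cases N with
  | zero =>
    rw [DeltaQ_zero hq hq1, hd 0]
    simp [fZero]
    field_simp
  | succ m =>
    have hm := one_sub_pow_succ_ne_zero ha m
    have hm' := one_sub_pow_succ_ne_zero ha (m + 1)
    rw [DeltaQ_succ hq hq1, hd m, hd (m + 1), fZero, if_neg m.succ_ne_zero]
    generalize (q : ℂ) ^ 2 = a at *
    field_simp
    ring

lemma norm_dilogSeries_le {a : ℂ} (ha : ‖a‖ < 1) :
    ∃ K : ℝ, ∀ N : ℕ, ‖dilogSeries a N‖ ≤ K * ((N + 1) * ‖a‖ ^ N) := by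
  have h0 : 0 < 1 - ‖a‖ := sub_pos.mpr ha
  set A := 2 / (1 - ‖a‖) ^ 2 * (1 - ‖a‖)⁻¹
  set B := (1 - ‖a‖)⁻¹ * (1 - ‖a‖)⁻¹
  have hA : 0 ≤ A := by positivity
  have hB : 0 ≤ B := by positivity
  refine ⟨A + B, fun N => ?_⟩
  have h1 := norm_weightedSeries_le ha (norm_dilogCoeff_le ha) N
  have h2 := norm_weightedSeries_le ha (norm_lambertCoeff_le ha) N
  calc ‖dilogSeries a N‖
      ≤ ‖weightedSeries a (dilogCoeff a) N‖ + N * ‖weightedSeries a (lambertCoeff a) N‖ := by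
        refine (norm_add_le _ _).trans ?_
        rw [norm_mul, Complex.norm_natCast]
    _ ≤ A * ‖a‖ ^ N + N * (B * ‖a‖ ^ N) := by
        gcongr
        · exact h1.trans_eq (by ring)
        · exact h2.trans_eq (by ring)
    _ ≤ (A + B) * ((N + 1) * ‖a‖ ^ N) := by
        have : 0 ≤ (A * N + B) * ‖a‖ ^ N := by positivity
        linarith

lemma summable_norm_gTwo_sq {q : ℝ} (hq : q ∈ Set.Ioo (0 : ℝ) 1) (ha : ‖(q : ℂ) ^ 2‖ < 1) :
    Summable (fun N : ℕ => ‖gTwo q N‖ ^ 2 * q ^ (-(2 * (N : ℤ)))) := by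
  obtain ⟨K, hK⟩ := norm_dilogSeries_le ha
  have hna : ‖(q : ℂ) ^ 2‖ = q ^ 2 := by
    rw [norm_pow, Complex.norm_real, Real.norm_of_nonneg hq.1.le]
  have hr : ‖q ^ 2‖ < 1 := by
    rwa [Real.norm_of_nonneg (by positivity), ← hna]
  have hs : Summable fun N : ℕ => ((N : ℝ) + 1) ^ 2 * (q ^ 2) ^ N := by
    have s0 := summable_pow_mul_geometric_of_norm_lt_one 0 hr
    have s1 := summable_pow_mul_geometric_of_norm_lt_one 1 hr
    have s2 := summable_pow_mul_geometric_of_norm_lt_one 2 hr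
    refine ((s2.add (s1.mul_left 2)).add s0).congr fun N => ?_
    ring
  refine .of_nonneg_of_le (fun N => ?_) (fun N => ?_)
    (hs.mul_left (‖(1 - (q : ℂ) ^ 2) ^ 3‖ ^ 2 * K ^ 2))
  · have := hq.1
    positivity
  · have hq0 := hq.1
    have e : q ^ (-(2 * (N : ℤ))) = ((q ^ 2) ^ N)⁻¹ := by
      rw [zpow_neg, ← pow_mul]; norm_cast
    have hN := hK N
    rw [hna] at hN
    rw [gTwo_eq_dilogSeries hq ha, norm_mul, mul_pow, e]
    calc ‖(1 - (q : ℂ) ^ 2) ^ 3‖ ^ 2 * ‖dilogSeries ((q : ℂ) ^ 2) N‖ ^ 2 * ((q ^ 2) ^ N)⁻¹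
        ≤ ‖(1 - (q : ℂ) ^ 2) ^ 3‖ ^ 2 * (K * ((N + 1) * (q ^ 2) ^ N)) ^ 2 * ((q ^ 2) ^ N)⁻¹ := by
          gcongr
      _ = ‖(1 - (q : ℂ) ^ 2) ^ 3‖ ^ 2 * K ^ 2 * (((N : ℝ) + 1) ^ 2 * (q ^ 2) ^ N) := by
          field_simp

/-- `g₂` belongs to `L²(dν)q⁰` and satisfies `Δ(Δ g₂) = f₀`,
i.e. `Δ⁻² f₀ = g₂`. -/
theorem deltaQ_inv_sq_fZero (q : ℝ) (hq : q ∈ Set.Ioo (0 : ℝ) 1) :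
    Summable (fun N : ℕ => ‖gTwo q N‖ ^ 2 * q ^ (-(2 * (N : ℤ)))) ∧
    (∀ N : ℕ, DeltaQ q (DeltaQ q (gTwo q)) N = fZero N) := by
  have ha : ‖(q : ℂ) ^ 2‖ < 1 := by
    rw [norm_pow, Complex.norm_real, Real.norm_of_nonneg hq.1.le]
    exact pow_lt_one₀ hq.1.le hq.2 two_ne_zero
  exact ⟨summable_norm_gTwo_sq hq ha, DeltaQ_DeltaQ_gTwo hq ha⟩

end
end

section
/- Let m ≥ 1 be an integer and suppose g ∈ L²(dν)q⁰ satisfies Δ^m g = f₀. Then for every N ∈ ℕ: g(q^{2N}) = ((−1)^m/(2πi)) (1−q²)^{2m} (q²;q²)_∞ q^N Σ_{k=0}^{∞} [q^{2Nk+2k}/(q²;q²)_k] · ∮_{|τ|=1} τ^{N+m-1}(1−τ²)(q^{2k+2}τ²;q²)_∞ / ((τ−q)^m (1−qτ)^m ((q^{2k+1}τ;q²)_∞)²) dτ, where the integral is taken counterclockwise over the unit circle (equivalently, (1/(2πi))·∮ equals the residue at the unique pole τ = q inside the unit circle). -/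
open scoped BigOperators

noncomputable section

open Filter Topology Metric

section QPochhammer

variable {Q : ℂ}

lemma multipliable_one_sub_mul_pow (hQ : ‖Q‖ < 1) (a : ℂ) :
    Multipliable fun j : ℕ => 1 - a * Q ^ j := by
  simp_rw [sub_eq_add_neg]
  apply multipliable_one_add_of_summable
  simpa using (summable_geometric_of_lt_one (norm_nonneg Q) hQ).mul_left ‖a‖

lemma qPochInf_eq_mul (hQ : ‖Q‖ < 1) (a : ℂ) :
    qPochInf a Q = (1 - a) * qPochInf (a * Q) Q := by
  unfold qPochInf
  have h : ∀ j : ℕ, 1 - a * Q * Q ^ j = 1 - a * Q ^ (j + 1) := fun j => by ring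
  have h1 := tprod_eq_zero_mul' (f := fun j : ℕ => 1 - a * Q ^ j)
    (by simpa only [h] using multipliable_one_sub_mul_pow hQ (a * Q))
  simpa only [h, pow_zero, mul_one] using h1

lemma qPochInf_eq_qPoch_mul (hQ : ‖Q‖ < 1) (a : ℂ) (k : ℕ) :
    qPochInf a Q = qPoch a Q k * qPochInf (a * Q ^ k) Q := by
  unfold qPochInf qPoch
  have h : ∀ j : ℕ, 1 - a * Q ^ k * Q ^ j = 1 - a * Q ^ (j + k) := fun j => by ring
  simp only [h]
  exact (Multipliable.prod_mul_tprod_nat_mul' (f := fun j : ℕ => 1 - a * Q ^ j) (k := k)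
    (by simpa only [h] using multipliable_one_sub_mul_pow hQ (a * Q ^ k))).symm

@[simp]
lemma qPochInf_zero : qPochInf 0 Q = 1 := by simp [qPochInf]

lemma qPochInf_one (hQ : ‖Q‖ < 1) : qPochInf 1 Q = 0 := by
  rw [qPochInf_eq_mul hQ]; simp

lemma qPochInf_ne_zero (hQ : ‖Q‖ < 1) {a : ℂ} (ha : ‖a‖ < 1) : qPochInf a Q ≠ 0 := by
  unfold qPochInf
  simp_rw [sub_eq_add_neg]
  refine tprod_one_add_ne_zero_of_summable (fun j h => ?_) ?_
  · have h1 : a * Q ^ j = 1 := by linear_combination -h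
    have h2 : ‖a‖ * ‖Q‖ ^ j = 1 := by rw [← norm_pow, ← norm_mul, h1, norm_one]
    have h3 : ‖Q‖ ^ j ≤ 1 := pow_le_one₀ (norm_nonneg Q) hQ.le
    nlinarith [norm_nonneg a]
  · simpa using (summable_geometric_of_lt_one (norm_nonneg Q) hQ).mul_left ‖a‖

lemma differentiable_qPochInf (hQ : ‖Q‖ < 1) : Differentiable ℂ fun a => qPochInf a Q := by
  intro a
  have h : HasProdLocallyUniformlyOn (fun (n : ℕ) (x : ℂ) => 1 + -(x * Q ^ n))
      (fun x => ∏' i : ℕ, (1 + -(x * Q ^ i))) (ball 0 (‖a‖ + 1)) := by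
    refine Summable.hasProdLocallyUniformlyOn_nat_one_add isOpen_ball
      ((summable_geometric_of_lt_one (norm_nonneg Q) hQ).mul_left (‖a‖ + 1))
      (.of_forall fun n x hx => ?_) (fun n => by fun_prop)
    rw [norm_neg, norm_mul, norm_pow]
    gcongr
    exact (mem_ball_zero_iff.1 hx).le
  have hd := h.differentiableOn (.of_forall fun _ => by
    simpa [Finset.prod_fn] using DifferentiableOn.finsetProd (fun _ _ => by fun_prop)) isOpen_ball
  simp only [← sub_eq_add_neg] at hd
  exact hd.differentiableAt (isOpen_ball.mem_nhds (by simp))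

lemma hasSum_pow_mul_qPochInf (hQ : ‖Q‖ < 1) :
    HasSum (fun k : ℕ => Q ^ k * qPochInf (Q * Q ^ k) Q) 1 := by
  have h : ∀ k : ℕ, Q ^ k * qPochInf (Q * Q ^ k) Q =
      qPochInf (Q ^ (k + 1)) Q - qPochInf (Q ^ k) Q := fun k => by
    rw [qPochInf_eq_mul hQ (Q ^ k)]; ring_nf
  have hc : Continuous fun a => qPochInf a Q := (differentiable_qPochInf hQ).continuous
  have ht : Tendsto (fun k : ℕ => qPochInf (Q ^ k) Q) atTop (𝓝 1) := by
    simpa [Function.comp_def] using (hc.tendsto 0).comp (tendsto_pow_atTop_nhds_zero_of_norm_lt_one hQ)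
  obtain ⟨M, hM⟩ := (isCompact_closedBall (0 : ℂ) 1).exists_bound_of_continuousOn hc.continuousOn
  have hs : Summable fun k : ℕ => Q ^ k * qPochInf (Q * Q ^ k) Q := by
    refine .of_norm_bounded ((summable_geometric_of_lt_one (norm_nonneg Q) hQ).mul_right M)
      fun k => ?_
    rw [norm_mul, norm_pow]
    gcongr
    refine hM _ (mem_closedBall_zero_iff.2 ?_)
    rw [← pow_succ', norm_pow]
    exact pow_le_one₀ (norm_nonneg Q) hQ.le
  refine (hs.hasSum_iff_tendsto_nat).2 ?_
  simp only [h, Finset.sum_range_sub (fun k => qPochInf (Q ^ k) Q)]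
  simpa [qPochInf_one hQ] using ht

end QPochhammer

section CircleIntegral

lemma circleIntegral_eq_zero_of_inv_eq_neg {f : ℂ → ℂ} (hf : ∀ z ∈ sphere (0 : ℂ) 1, f z⁻¹ = -f z) :
    (∮ z in C(0, 1), z⁻¹ * f z) = 0 := by
  have h1 : ∀ θ : ℝ, circleMap 0 1 (2 * Real.pi - θ) = (circleMap 0 1 θ)⁻¹ := fun θ => by
    simp [circleMap, ← Complex.exp_neg, sub_mul, Complex.exp_sub]
  have h2 : (∮ z in C(0, 1), z⁻¹ * f z) = ∫ θ in 0..2 * Real.pi, Complex.I * f (circleMap 0 1 θ) := by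
    refine intervalIntegral.integral_congr fun θ _ => ?_
    have : circleMap 0 1 θ ≠ 0 := circleMap_ne_center one_ne_zero
    simp only [deriv_circleMap, smul_eq_mul]
    field_simp
  have h3 := intervalIntegral.integral_comp_sub_left (a := 0) (b := 2 * Real.pi)
    (fun θ : ℝ => Complex.I * f (circleMap 0 1 θ)) (2 * Real.pi)
  simp only [h1, sub_self, sub_zero] at h3
  rw [h2]
  have h4 : (∫ θ in 0..2 * Real.pi, Complex.I * f (circleMap 0 1 θ)⁻¹) =
      -∫ θ in 0..2 * Real.pi, Complex.I * f (circleMap 0 1 θ) := by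
    rw [← intervalIntegral.integral_neg]
    refine intervalIntegral.integral_congr fun θ _ => ?_
    simp [hf _ (circleMap_mem_sphere 0 zero_le_one θ)]
  rw [h4] at h3
  linear_combination -(1 / 2) * h3

lemma tendsto_circleIntegral_of_continuousOn_prod {F : ℂ → ℂ → ℂ} {K : Set ℂ} (hK : IsCompact K)
    {s₀ : ℂ} (hs₀ : s₀ ∈ K) (hF : ContinuousOn (Function.uncurry F) (K ×ˢ sphere 0 1))
    {s : ℕ → ℂ} (hs : Tendsto s atTop (𝓝 s₀)) (hsK : ∀ k, s k ∈ K) :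
    Tendsto (fun k => ∮ z in C(0, 1), F (s k) z) atTop (𝓝 (∮ z in C(0, 1), F s₀ z)) := by
  have hu : TendstoUniformlyOn F (F s₀) (𝓝[K] s₀) (sphere 0 1) :=
    ((hK.prod (isCompact_sphere 0 1)).uniformContinuousOn_of_continuous hF).tendstoUniformlyOn hs₀
  have hs' : Tendsto s atTop (𝓝[K] s₀) :=
    tendsto_nhdsWithin_iff.2 ⟨hs, .of_forall hsK⟩
  refine TendstoUniformlyOn.tendsto_circleIntegral_of_continuousOn zero_le_one
    (.of_forall fun k => ?_) fun u hu' => hs'.eventually (hu u hu')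
  exact hF.comp (by fun_prop : ContinuousOn (fun z : ℂ => (s k, z)) _) fun z hz => ⟨hsK k, hz⟩

end CircleIntegral

section GreenSeries

/-- The ratio of infinite `c²`-Pochhammer symbols occurring in the Green function integrand,
with the discrete variable `c ^ (2 * k)` replaced by a complex variable `s`. -/
def greenKernel (c s τ : ℂ) : ℂ :=
  qPochInf (c ^ 2 * s) (c ^ 2) * qPochInf (c ^ 2 * s * τ ^ 2) (c ^ 2) /
    qPochInf (c * s * τ) (c ^ 2) ^ 2

/-- The weight `τ⁻¹ (1 - τ²) (τ / ((τ - c) (1 - c τ)))ᵐ`. -/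
def greenWeight (c : ℂ) (m : ℕ) (τ : ℂ) : ℂ :=
  τ⁻¹ * ((1 - τ ^ 2) * (τ / ((τ - c) * (1 - c * τ))) ^ m)

/-- The integrand of the Green function of `Δᵐ`. -/
def greenIntegrand (c : ℂ) (m N : ℕ) (s τ : ℂ) : ℂ :=
  (c * τ) ^ N * (greenWeight c m τ * greenKernel c s τ)

/-- The integrand of the discrete flux through which the `c²`-difference equation telescopes. -/
def greenFlux (c : ℂ) (m N : ℕ) (s τ : ℂ) : ℂ :=
  (c * τ) ^ N * (greenWeight c m τ * greenKernel c s τ) * ((1 - s) * (c * τ⁻¹ - c * τ * s))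

/-- The terms of the series `greenSeries`. -/
def greenTerm (c : ℂ) (m N k : ℕ) : ℂ :=
  (c ^ 2) ^ ((N + 1) * k) * ∮ τ in C(0, 1), greenIntegrand c m N ((c ^ 2) ^ k) τ

/-- The Green function of `Δᵐ`, up to a normalizing factor. -/
def greenSeries (c : ℂ) (m N : ℕ) : ℂ := ∑' k : ℕ, greenTerm c m N k

variable {c : ℂ}

lemma norm_sq_lt_one (hc : ‖c‖ < 1) : ‖c ^ 2‖ < 1 := by
  rw [norm_pow]
  exact pow_lt_one₀ (norm_nonneg c) hc two_ne_zero

lemma norm_mul_mul_lt_one (hc : ‖c‖ < 1) {s τ : ℂ} (hs : ‖s‖ ≤ 1) (hτ : ‖τ‖ ≤ 1) :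
    ‖c * s * τ‖ < 1 := by
  rw [norm_mul, norm_mul]
  calc ‖c‖ * ‖s‖ * ‖τ‖ ≤ ‖c‖ * 1 * 1 := by gcongr
    _ < 1 := by simpa using hc

lemma greenKernel_denom_ne_zero (hc : ‖c‖ < 1) {s τ : ℂ} (hs : ‖s‖ ≤ 1) (hτ : ‖τ‖ ≤ 1) :
    qPochInf (c * s * τ) (c ^ 2) ≠ 0 :=
  qPochInf_ne_zero (norm_sq_lt_one hc) (norm_mul_mul_lt_one hc hs hτ)

lemma continuousOn_greenKernel (hc : ‖c‖ < 1) :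
    ContinuousOn (Function.uncurry (greenKernel c)) (closedBall 0 1 ×ˢ closedBall 0 1) := by
  have h : Continuous fun a => qPochInf a (c ^ 2) :=
    (differentiable_qPochInf (norm_sq_lt_one hc)).continuous
  refine ContinuousOn.div (Continuous.continuousOn ?_) (Continuous.continuousOn ?_) fun p hp => ?_
  · exact (h.comp (by fun_prop : Continuous fun p : ℂ × ℂ => c ^ 2 * p.1)).mul
      (h.comp (by fun_prop : Continuous fun p : ℂ × ℂ => c ^ 2 * p.1 * p.2 ^ 2))
  · exact (h.comp (by fun_prop : Continuous fun p : ℂ × ℂ => c * p.1 * p.2)).pow 2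
  · exact pow_ne_zero 2 (greenKernel_denom_ne_zero hc (mem_closedBall_zero_iff.1 hp.1)
      (mem_closedBall_zero_iff.1 hp.2))

lemma differentiableAt_greenKernel (hc : ‖c‖ < 1) {s τ : ℂ} (hs : ‖s‖ ≤ 1) (hτ : ‖τ‖ ≤ 1) :
    DifferentiableAt ℂ (greenKernel c s) τ := by
  have h := differentiable_qPochInf (norm_sq_lt_one hc)
  refine DifferentiableAt.div (DifferentiableAt.mul (by fun_prop) ?_) (DifferentiableAt.pow ?_ 2)
    (pow_ne_zero 2 (greenKernel_denom_ne_zero hc hs hτ))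
  · exact (h.comp (by fun_prop : Differentiable ℂ fun τ : ℂ => c ^ 2 * s * τ ^ 2)) τ
  · exact (h.comp (by fun_prop : Differentiable ℂ fun τ : ℂ => c * s * τ)) τ

lemma greenKernel_zero_left (τ : ℂ) : greenKernel c 0 τ = 1 := by simp [greenKernel]

lemma greenKernel_zero_right (s : ℂ) : greenKernel c s 0 = qPochInf (c ^ 2 * s) (c ^ 2) := by
  simp [greenKernel]

lemma greenKernel_mul_sq (hc : ‖c‖ < 1) {s τ : ℂ} (hs : ‖s‖ ≤ 1) (hτ : ‖τ‖ ≤ 1) :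
    (1 - c ^ 2 * s) * (1 - c ^ 2 * s * τ ^ 2) * greenKernel c (s * c ^ 2) τ =
      (1 - c * s * τ) ^ 2 * greenKernel c s τ := by
  have hQ := norm_sq_lt_one hc
  have h0 := greenKernel_denom_ne_zero hc hs hτ
  rw [qPochInf_eq_mul hQ] at h0
  obtain ⟨h1, h2⟩ := mul_ne_zero_iff.1 h0
  unfold greenKernel
  rw [qPochInf_eq_mul hQ (c ^ 2 * s), qPochInf_eq_mul hQ (c ^ 2 * s * τ ^ 2),
    qPochInf_eq_mul hQ (c * s * τ)]
  rw [show c ^ 2 * (s * c ^ 2) = c ^ 2 * s * c ^ 2 by ring,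
    show c ^ 2 * s * c ^ 2 * τ ^ 2 = c ^ 2 * s * τ ^ 2 * c ^ 2 by ring,
    show c * (s * c ^ 2) * τ = c * s * τ * c ^ 2 by ring]
  field_simp

lemma sub_ne_zero_of_mem_sphere (hc : ‖c‖ < 1) {τ : ℂ} (hτ : τ ∈ sphere (0 : ℂ) 1) :
    τ - c ≠ 0 := by
  rintro h
  rw [mem_sphere_zero_iff_norm, sub_eq_zero.1 h] at hτ
  exact hc.ne hτ

lemma one_sub_mul_ne_zero_of_mem_sphere (hc : ‖c‖ < 1) {τ : ℂ} (hτ : τ ∈ sphere (0 : ℂ) 1) :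
    1 - c * τ ≠ 0 := by
  rintro h
  have h1 := congrArg norm (sub_eq_zero.1 h)
  rw [norm_one, norm_mul, mem_sphere_zero_iff_norm.1 hτ, mul_one] at h1
  exact hc.ne h1.symm

lemma ne_zero_of_mem_unit_circle {τ : ℂ} (hτ : τ ∈ sphere (0 : ℂ) 1) : τ ≠ 0 := by
  rintro rfl
  simp at hτ

lemma continuousOn_greenWeight (hc : ‖c‖ < 1) (m : ℕ) :
    ContinuousOn (greenWeight c m) (sphere 0 1) := by
  refine ContinuousOn.mul (continuousOn_inv₀.mono fun τ hτ => ne_zero_of_mem_unit_circle hτ)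
    (ContinuousOn.mul (by fun_prop) (ContinuousOn.pow (ContinuousOn.div (by fun_prop)
      (by fun_prop) fun τ hτ => mul_ne_zero (sub_ne_zero_of_mem_sphere hc hτ)
        (one_sub_mul_ne_zero_of_mem_sphere hc hτ)) m))

lemma greenWeight_eq_succ (hc : ‖c‖ < 1) (m : ℕ) {τ : ℂ} (hτ : τ ∈ sphere (0 : ℂ) 1) :
    greenWeight c m τ = greenWeight c (m + 1) τ * ((τ - c) * (1 - c * τ) * τ⁻¹) := by
  have h1 := sub_ne_zero_of_mem_sphere hc hτ
  have h2 := one_sub_mul_ne_zero_of_mem_sphere hc hτ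
  have h3 := ne_zero_of_mem_unit_circle hτ
  have hu : τ / ((τ - c) * (1 - c * τ)) * ((τ - c) * (1 - c * τ) * τ⁻¹) = 1 := by
    rw [← mul_assoc, div_mul_cancel₀ _ (mul_ne_zero h1 h2), mul_inv_cancel₀ h3]
  unfold greenWeight
  rw [pow_succ (τ / _)]
  linear_combination -τ⁻¹ * (1 - τ ^ 2) * (τ / ((τ - c) * (1 - c * τ))) ^ m * hu

lemma continuousOn_weight_mul_kernel (hc : ‖c‖ < 1) (m : ℕ) :
    ContinuousOn (fun p : ℂ × ℂ => greenWeight c m p.2 * greenKernel c p.1 p.2)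
      (closedBall 0 1 ×ˢ sphere 0 1) := by
  have h1 : ContinuousOn (fun p : ℂ × ℂ => greenWeight c m p.2) (closedBall 0 1 ×ˢ sphere 0 1) :=
    (continuousOn_greenWeight hc m).comp continuousOn_snd fun _ hp => hp.2
  have h2 : ContinuousOn (fun p : ℂ × ℂ => greenKernel c p.1 p.2)
      (closedBall 0 1 ×ˢ sphere 0 1) :=
    (continuousOn_greenKernel hc).mono (Set.prod_mono_right sphere_subset_closedBall)
  exact h1.mul h2

lemma continuousOn_greenIntegrand (hc : ‖c‖ < 1) (m N : ℕ) {s : ℂ} (hs : ‖s‖ ≤ 1) :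
    ContinuousOn (greenIntegrand c m N s) (sphere 0 1) := by
  have h : ContinuousOn (fun τ => greenWeight c m τ * greenKernel c s τ) (sphere 0 1) :=
    (continuousOn_weight_mul_kernel hc m).comp (f := fun τ : ℂ => (s, τ)) (by fun_prop)
      fun _ hτ => ⟨mem_closedBall_zero_iff.2 hs, hτ⟩
  unfold greenIntegrand
  fun_prop

lemma continuousOn_greenFlux (hc : ‖c‖ < 1) (m N : ℕ) :
    ContinuousOn (Function.uncurry (greenFlux c m N)) (closedBall 0 1 ×ˢ sphere 0 1) := by
  have h1 := continuousOn_weight_mul_kernel hc m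
  have h2 : ContinuousOn (fun p : ℂ × ℂ => p.2⁻¹) (closedBall 0 1 ×ˢ sphere 0 1) :=
    continuousOn_snd.inv₀ fun p hp => ne_zero_of_mem_unit_circle hp.2
  have h3 : ContinuousOn (fun p : ℂ × ℂ => (c * p.2) ^ N *
      (greenWeight c m p.2 * greenKernel c p.1 p.2) *
        ((1 - p.1) * (c * p.2⁻¹ - c * p.2 * p.1))) (closedBall 0 1 ×ˢ sphere 0 1) := by
    fun_prop
  exact h3

lemma continuousOn_greenFlux_right (hc : ‖c‖ < 1) (m N : ℕ) {s : ℂ} (hs : ‖s‖ ≤ 1) :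
    ContinuousOn (greenFlux c m N s) (sphere 0 1) :=
  (continuousOn_greenFlux hc m N).comp (f := fun τ : ℂ => (s, τ)) (by fun_prop)
    fun _ hτ => ⟨mem_closedBall_zero_iff.2 hs, hτ⟩

lemma norm_sq_pow_le_one (hc : ‖c‖ < 1) (k : ℕ) : ‖(c ^ 2) ^ k‖ ≤ 1 := by
  rw [norm_pow]
  exact pow_le_one₀ (norm_nonneg _) (norm_sq_lt_one hc).le

lemma exists_norm_greenTerm_le (hc : ‖c‖ < 1) (m : ℕ) :
    ∃ M : ℝ, ∀ N k : ℕ, ‖greenTerm c m N k‖ ≤ ‖c‖ ^ N * (‖c ^ 2‖ ^ k * M) := by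
  obtain ⟨M, hM⟩ := ((isCompact_closedBall (0 : ℂ) 1).prod
    (isCompact_sphere (0 : ℂ) 1)).exists_bound_of_continuousOn
      (continuousOn_weight_mul_kernel hc m)
  refine ⟨2 * Real.pi * 1 * M, fun N k => ?_⟩
  have h1 : ‖∮ τ in C(0, 1), greenIntegrand c m N ((c ^ 2) ^ k) τ‖ ≤
      2 * Real.pi * 1 * (‖c‖ ^ N * M) := by
    refine circleIntegral.norm_integral_le_of_norm_le_const zero_le_one fun τ hτ => ?_
    rw [greenIntegrand, norm_mul, norm_pow, norm_mul, mem_sphere_zero_iff_norm.1 hτ, mul_one]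
    gcongr
    exact hM (_, τ) ⟨mem_closedBall_zero_iff.2 (norm_sq_pow_le_one hc k), hτ⟩
  have h2 : ‖(c ^ 2) ^ ((N + 1) * k)‖ ≤ ‖c ^ 2‖ ^ k := by
    rw [norm_pow]
    exact pow_le_pow_of_le_one (norm_nonneg _) (norm_sq_lt_one hc).le (by nlinarith)
  calc ‖greenTerm c m N k‖ ≤ ‖c ^ 2‖ ^ k * (2 * Real.pi * 1 * (‖c‖ ^ N * M)) := by
        rw [greenTerm, norm_mul]; gcongr
    _ = _ := by ring

lemma summable_greenTerm (hc : ‖c‖ < 1) (m N : ℕ) : Summable (greenTerm c m N) := by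
  obtain ⟨M, hM⟩ := exists_norm_greenTerm_le hc m
  exact .of_norm_bounded (((summable_geometric_of_lt_one (norm_nonneg _)
    (norm_sq_lt_one hc)).mul_right M).mul_left _) (hM N)

lemma tendsto_greenSeries (hc : ‖c‖ < 1) (m : ℕ) : Tendsto (greenSeries c m) atTop (𝓝 0) := by
  obtain ⟨M, hM⟩ := exists_norm_greenTerm_le hc m
  have hs := (summable_geometric_of_lt_one (norm_nonneg _) (norm_sq_lt_one hc)).mul_right M
  refine squeeze_zero_norm (a := fun N => ‖c‖ ^ N * ∑' k : ℕ, ‖c ^ 2‖ ^ k * M) (fun N => ?_) ?_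
  · rw [← tsum_mul_left]
    exact tsum_of_norm_bounded (hs.mul_left _).hasSum (hM N)
  · simpa using (tendsto_pow_atTop_nhds_zero_of_lt_one (norm_nonneg c) hc).mul_const _

lemma greenSeries_zero_left (hc : ‖c‖ < 1) (N : ℕ) :
    greenSeries c 0 N = 2 * Real.pi * Complex.I * fZero N := by
  have hI : ∀ k : ℕ, (∮ τ in C(0, 1), greenIntegrand c 0 N ((c ^ 2) ^ k) τ) =
      2 * Real.pi * Complex.I * (0 ^ N * qPochInf (c ^ 2 * (c ^ 2) ^ k) (c ^ 2)) := fun k => by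
    set s := (c ^ 2) ^ k
    have hs : ‖s‖ ≤ 1 := norm_sq_pow_le_one hc k
    have hd : ∀ τ ∈ closedBall (0 : ℂ) 1, DifferentiableAt ℂ
        (fun τ => (c * τ) ^ N * ((1 - τ ^ 2) * greenKernel c s τ)) τ := fun τ hτ => by
      have := differentiableAt_greenKernel hc hs (mem_closedBall_zero_iff.1 hτ)
      fun_prop
    have h := Complex.circleIntegral_sub_center_inv_smul_of_differentiable_on_off_countable
      one_pos Set.countable_empty
      (fun τ hτ => (hd τ hτ).continuousAt.continuousWithinAt)
      (fun τ hτ => hd τ (ball_subset_closedBall hτ.1))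
    simp only [sub_zero, smul_eq_mul, greenKernel_zero_right, mul_zero] at h
    rw [show (1 : ℂ) - 0 ^ 2 = 1 by norm_num, one_mul] at h
    rw [← h]
    congr 1
    funext τ
    simp only [greenIntegrand, greenWeight, pow_zero]
    ring
  rcases N with _ | N
  · have h := (hasSum_pow_mul_qPochInf (norm_sq_lt_one hc)).mul_left (2 * Real.pi * Complex.I)
    rw [fZero, if_pos rfl, ← h.tsum_eq]
    refine tsum_congr fun k => ?_
    rw [greenTerm, hI]
    ring
  · simp [greenSeries, greenTerm, hI, fZero]

lemma circleIntegral_greenFlux_zero (hc : ‖c‖ < 1) (m : ℕ) :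
    (∮ τ in C(0, 1), greenFlux c m 0 0 τ) = 0 := by
  refine Eq.trans ?_ (circleIntegral_eq_zero_of_inv_eq_neg (f := fun τ =>
    (1 - τ ^ 2) * (τ / ((τ - c) * (1 - c * τ))) ^ m * (c * τ⁻¹)) ?_)
  · congr 1
    funext τ
    simp only [greenFlux, greenWeight, greenKernel_zero_left]
    ring
  · intro τ hτ
    have h1 := sub_ne_zero_of_mem_sphere hc hτ
    have h2 := one_sub_mul_ne_zero_of_mem_sphere hc hτ
    have h3 := ne_zero_of_mem_unit_circle hτ
    have h4 : τ⁻¹ / ((τ⁻¹ - c) * (1 - c * τ⁻¹)) = τ / ((τ - c) * (1 - c * τ)) := by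
      rw [show τ⁻¹ - c = (1 - c * τ) * τ⁻¹ by field_simp,
        show 1 - c * τ⁻¹ = (τ - c) * τ⁻¹ by field_simp]
      field_simp
    simp only [h4]
    field_simp
    ring

lemma tendsto_greenFlux (hc : ‖c‖ < 1) (m N : ℕ) :
    Tendsto (fun k : ℕ => (c ^ 2) ^ (N * k) * ∮ τ in C(0, 1), greenFlux c m N ((c ^ 2) ^ k) τ)
      atTop (𝓝 0) := by
  have h := tendsto_circleIntegral_of_continuousOn_prod (isCompact_closedBall 0 1)
    (mem_closedBall_self zero_le_one) (continuousOn_greenFlux hc m N)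
    (tendsto_pow_atTop_nhds_zero_of_norm_lt_one (norm_sq_lt_one hc))
    (fun k => mem_closedBall_zero_iff.2 (norm_sq_pow_le_one hc k))
  rcases N with _ | N
  · rw [circleIntegral_greenFlux_zero hc] at h
    simpa using h
  · have hN : ‖(c ^ 2) ^ (N + 1)‖ < 1 := by
      rw [norm_pow]
      exact pow_lt_one₀ (norm_nonneg _) (norm_sq_lt_one hc) N.succ_ne_zero
    simpa only [pow_mul, zero_mul] using (tendsto_pow_atTop_nhds_zero_of_norm_lt_one hN).mul h

lemma greenIntegrand_recurrence (hc : ‖c‖ < 1) (hc0 : c ≠ 0) (m N k : ℕ) {τ : ℂ}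
    (hτ : τ ∈ sphere (0 : ℂ) 1) :
    (1 - (c ^ 2) ^ N) * c ^ 2 * (c ^ 2) ^ ((N - 1 + 1) * k) *
          greenIntegrand c (m + 1) (N - 1) ((c ^ 2) ^ k) τ +
        (-(1 - (c ^ 2) ^ N) * c ^ 2 - (1 - (c ^ 2) ^ (N + 1))) * (c ^ 2) ^ ((N + 1) * k) *
          greenIntegrand c (m + 1) N ((c ^ 2) ^ k) τ +
        (1 - (c ^ 2) ^ (N + 1)) * (c ^ 2) ^ ((N + 1 + 1) * k) *
          greenIntegrand c (m + 1) (N + 1) ((c ^ 2) ^ k) τ +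
        (c ^ 2) ^ ((N + 1) * k) * greenIntegrand c m N ((c ^ 2) ^ k) τ +
        -(c ^ 2) ^ (N * k) * greenFlux c (m + 1) N ((c ^ 2) ^ k) τ +
        (c ^ 2) ^ (N * (k + 1)) * greenFlux c (m + 1) N ((c ^ 2) ^ (k + 1)) τ = 0 := by
  have h3 := ne_zero_of_mem_unit_circle hτ
  have hN : (1 - (c ^ 2) ^ N) * ((c ^ 2) ^ ((N - 1 + 1) * k) * (c * τ) ^ (N - 1)) =
      (1 - (c ^ 2) ^ N) * ((c ^ 2) ^ (N * k) * ((c * τ) ^ N * (c⁻¹ * τ⁻¹))) := by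
    rcases N with _ | N
    · simp
    · rw [Nat.add_sub_cancel, pow_succ (c * τ)]
      field_simp
  have hB := greenKernel_mul_sq hc (norm_sq_pow_le_one hc k)
    (mem_sphere_zero_iff_norm.1 hτ).le
  simp only [greenIntegrand, greenFlux, greenWeight_eq_succ hc m hτ]
  rw [show (N + 1 + 1) * k = N * k + k + k by ring, show (N + 1) * k = N * k + k by ring,
    show N * (k + 1) = N * k + N by ring]
  simp only [pow_add _ _ k, pow_add _ (N * k) N, pow_succ _ N, pow_succ _ k]
  generalize greenKernel c ((c ^ 2) ^ k * c ^ 2) τ = B' at *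
  generalize greenKernel c ((c ^ 2) ^ k) τ = B at *
  generalize (c ^ 2) ^ k = s at *
  generalize greenWeight c (m + 1) τ = W at *
  generalize (c ^ 2) ^ ((N - 1 + 1) * k) = p' at *
  generalize (c ^ 2) ^ (N * k) = p at *
  generalize (c ^ 2) ^ N = y at *
  generalize (c * τ) ^ (N - 1) = X' at *
  generalize (c * τ) ^ N = X at *
  have e : c * τ⁻¹ - c * τ * (s * c ^ 2) = c * τ⁻¹ * (1 - c ^ 2 * s * τ ^ 2) := by
    field_simp
  rw [e]
  linear_combination (norm := (field_simp; ring)) c ^ 2 * W * B * hN + p * y * X * W * c * τ⁻¹ * hB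

lemma greenTerm_recurrence (hc : ‖c‖ < 1) (hc0 : c ≠ 0) (m N k : ℕ) :
    (1 - (c ^ 2) ^ N) * c ^ 2 * (greenTerm c (m + 1) (N - 1) k - greenTerm c (m + 1) N k) -
        (1 - (c ^ 2) ^ (N + 1)) * (greenTerm c (m + 1) N k - greenTerm c (m + 1) (N + 1) k) +
        greenTerm c m N k =
      (c ^ 2) ^ (N * k) * (∮ τ in C(0, 1), greenFlux c (m + 1) N ((c ^ 2) ^ k) τ) -
        (c ^ 2) ^ (N * (k + 1)) *
          ∮ τ in C(0, 1), greenFlux c (m + 1) N ((c ^ 2) ^ (k + 1)) τ := by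
  have hg : ∀ m N, ContinuousOn (greenIntegrand c m N ((c ^ 2) ^ k)) (sphere 0 1) := fun m N =>
    continuousOn_greenIntegrand hc m N (norm_sq_pow_le_one hc k)
  have hf : ∀ k, ContinuousOn (greenFlux c (m + 1) N ((c ^ 2) ^ k)) (sphere 0 1) := fun k =>
    continuousOn_greenFlux_right hc (m + 1) N (norm_sq_pow_le_one hc k)
  have h1 := hg (m + 1) (N - 1)
  have h2 := hg (m + 1) N
  have h3 := hg (m + 1) (N + 1)
  have h4 := hg m N
  have h5 := hf k
  have h6 := hf (k + 1)
  have h := circleIntegral.integral_congr zero_le_one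
    (fun τ hτ => greenIntegrand_recurrence hc hc0 m N k hτ)
  rw [circleIntegral.integral_add (ContinuousOn.circleIntegrable zero_le_one (by fun_prop))
      (ContinuousOn.circleIntegrable zero_le_one (by fun_prop)),
    circleIntegral.integral_add (ContinuousOn.circleIntegrable zero_le_one (by fun_prop))
      (ContinuousOn.circleIntegrable zero_le_one (by fun_prop)),
    circleIntegral.integral_add (ContinuousOn.circleIntegrable zero_le_one (by fun_prop))
      (ContinuousOn.circleIntegrable zero_le_one (by fun_prop)),
    circleIntegral.integral_add (ContinuousOn.circleIntegrable zero_le_one (by fun_prop))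
      (ContinuousOn.circleIntegrable zero_le_one (by fun_prop)),
    circleIntegral.integral_add (ContinuousOn.circleIntegrable zero_le_one (by fun_prop))
      (ContinuousOn.circleIntegrable zero_le_one (by fun_prop))] at h
  simp only [circleIntegral.integral_const_mul] at h
  rw [show (∮ _ in C((0 : ℂ), 1), (0 : ℂ)) = 0 by simp [circleIntegral]] at h
  simp only [greenTerm]
  linear_combination h

lemma greenSeries_recurrence (hc : ‖c‖ < 1) (hc0 : c ≠ 0) (m N : ℕ) :
    (1 - (c ^ 2) ^ N) * c ^ 2 * (greenSeries c (m + 1) (N - 1) - greenSeries c (m + 1) N) -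
        (1 - (c ^ 2) ^ (N + 1)) * (greenSeries c (m + 1) N - greenSeries c (m + 1) (N + 1)) =
      -greenSeries c m N := by
  have hs := fun m N => (summable_greenTerm hc m N).hasSum
  have h := ((((hs (m + 1) (N - 1)).sub (hs (m + 1) N)).mul_left ((1 - (c ^ 2) ^ N) * c ^ 2)).sub
    (((hs (m + 1) N).sub (hs (m + 1) (N + 1))).mul_left (1 - (c ^ 2) ^ (N + 1)))).add (hs m N)
  have ht := h.tendsto_sum_nat
  simp only [greenTerm_recurrence hc hc0, Finset.sum_range_sub' (fun k => (c ^ 2) ^ (N * k) *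
    ∮ τ in C(0, 1), greenFlux c (m + 1) N ((c ^ 2) ^ k) τ)] at ht
  have h0 : ∀ τ, greenFlux c (m + 1) N ((c ^ 2) ^ 0) τ = 0 := fun τ => by simp [greenFlux]
  have h1 := (tendsto_greenFlux hc (m + 1) N).const_sub
    ((c ^ 2) ^ (N * 0) * ∮ τ in C(0, 1), greenFlux c (m + 1) N ((c ^ 2) ^ 0) τ)
  have h2 := tendsto_nhds_unique ht h1
  simp only [h0] at h2
  rw [show (∮ _ in C((0 : ℂ), 1), (0 : ℂ)) = 0 by simp [circleIntegral]] at h2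
  unfold greenSeries
  linear_combination h2

end GreenSeries

section DeltaQ

variable {q : ℝ}

lemma deltaQ_eq (hq : q ∈ Set.Ioo (0 : ℝ) 1) (f : ℕ → ℂ) (N : ℕ) :
    DeltaQ q f N = ((1 - (q : ℂ) ^ 2) ^ 2)⁻¹ *
      ((1 - ((q : ℂ) ^ 2) ^ N) * (q : ℂ) ^ 2 * (f (N - 1) - f N) -
        (1 - ((q : ℂ) ^ 2) ^ (N + 1)) * (f N - f (N + 1))) := by
  have h0 : (q : ℂ) ≠ 0 := by exact_mod_cast hq.1.ne'
  have h1 : (1 - (q : ℂ) ^ 2) ≠ 0 := by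
    have : 1 - q ^ 2 ≠ 0 := by nlinarith [hq.1, hq.2]
    exact_mod_cast this
  have hp : ((q : ℂ) ^ 2) ^ N ≠ 0 := pow_ne_zero _ (pow_ne_zero _ h0)
  have e1 : (q : ℂ) ^ (2 * (N : ℤ)) = ((q : ℂ) ^ 2) ^ N := by
    rw [← pow_mul]; exact_mod_cast rfl
  have e4 : (q : ℂ) ^ (4 * (N : ℤ)) = (((q : ℂ) ^ 2) ^ N) ^ 2 := by
    rw [← e1, ← zpow_natCast, ← zpow_mul]; congr 1; push_cast; ring
  have hif : (if N = 0 then 0 else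
        (1 - (q : ℂ) ^ (2 * (N : ℤ))) * (f (N - 1) - f N) /
          ((q : ℂ) ^ (2 * (N : ℤ) - 2) - (q : ℂ) ^ (2 * (N : ℤ)))) =
        (1 - (q : ℂ) ^ (2 * (N : ℤ))) * (f (N - 1) - f N) /
          ((q : ℂ) ^ (2 * (N : ℤ) - 2) - (q : ℂ) ^ (2 * (N : ℤ))) := by
    split_ifs with h
    · simp [h]
    · rfl
  unfold DeltaQ
  rw [hif]
  simp only [zpow_sub₀ h0, zpow_add₀ h0, e1, e4, pow_succ _ N]
  generalize ((q : ℂ) ^ 2) ^ N = y at *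
  rw [show (q : ℂ) ^ (2 : ℤ) = (q : ℂ) ^ 2 from rfl, zpow_one, zpow_neg_one,
    show y / (q : ℂ) ^ 2 - y = y * (1 - (q : ℂ) ^ 2) / (q : ℂ) ^ 2 by field_simp,
    show y - y * (q : ℂ) ^ 2 = y * (1 - (q : ℂ) ^ 2) by ring,
    show y / (q : ℂ) - y * q = y * (1 - (q : ℂ) ^ 2) / q by field_simp]
  field_simp

lemma norm_ofReal_lt_one (hq : q ∈ Set.Ioo (0 : ℝ) 1) : ‖(q : ℂ)‖ < 1 := by
  rw [Complex.norm_real, Real.norm_of_nonneg hq.1.le]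
  exact hq.2

lemma tendsto_deltaQ (hq : q ∈ Set.Ioo (0 : ℝ) 1) {f : ℕ → ℂ} (hf : Tendsto f atTop (𝓝 0)) :
    Tendsto (DeltaQ q f) atTop (𝓝 0) := by
  have hQ : Tendsto (fun N : ℕ => ((q : ℂ) ^ 2) ^ N) atTop (𝓝 0) := by
    refine tendsto_pow_atTop_nhds_zero_of_norm_lt_one (norm_sq_lt_one (norm_ofReal_lt_one hq))
  have hf1 : Tendsto (fun N => f (N - 1)) atTop (𝓝 0) := hf.comp (tendsto_sub_atTop_nat 1)
  have hf2 := (tendsto_add_atTop_iff_nat 1).2 hf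
  have hQ2 := (tendsto_add_atTop_iff_nat 1).2 hQ
  have h := ((((hQ.const_sub 1).mul_const ((q : ℂ) ^ 2)).mul (hf1.sub hf)).sub
    ((hQ2.const_sub 1).mul (hf.sub hf2))).const_mul ((1 - (q : ℂ) ^ 2) ^ 2)⁻¹
  simpa [funext (deltaQ_eq hq f)] using h

lemma deltaQ_injOn (hq : q ∈ Set.Ioo (0 : ℝ) 1) {f g : ℕ → ℂ} (hf : Tendsto f atTop (𝓝 0))
    (hg : Tendsto g atTop (𝓝 0)) (h : DeltaQ q f = DeltaQ q g) : f = g := by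
  have hlt : ∀ n : ℕ, n ≠ 0 → (1 - (q : ℂ) ^ n) ≠ 0 := fun n hn => by
    have : 1 - q ^ n ≠ 0 := (sub_pos.2 (pow_lt_one₀ hq.1.le hq.2 hn)).ne'
    exact_mod_cast this
  have hstep : ∀ N : ℕ, f N - g N = f (N + 1) - g (N + 1) := fun N => by
    induction N with
    | zero =>
      have h1 := congrFun h 0
      rw [deltaQ_eq hq, deltaQ_eq hq] at h1
      have h2 := mul_left_cancel₀ (inv_ne_zero (pow_ne_zero 2 (hlt 2 two_ne_zero))) h1
      refine mul_left_cancel₀ (hlt 2 two_ne_zero) ?_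
      simp only [pow_zero, zero_add, pow_one, sub_self, zero_mul, zero_sub] at h2 ⊢
      linear_combination -h2
    | succ N ih =>
      have h1 := congrFun h (N + 1)
      rw [deltaQ_eq hq, deltaQ_eq hq] at h1
      have h2 := mul_left_cancel₀ (inv_ne_zero (pow_ne_zero 2 (hlt 2 two_ne_zero))) h1
      have h3 := hlt (2 * (N + 1 + 1)) (by positivity)
      rw [pow_mul] at h3
      refine mul_left_cancel₀ h3 ?_
      simp only [Nat.add_sub_cancel] at h2
      linear_combination -h2 + (1 - ((q : ℂ) ^ 2) ^ (N + 1)) * (q : ℂ) ^ 2 * ih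
  have hconst : ∀ N : ℕ, f N - g N = f 0 - g 0 := fun N => by
    induction N with
    | zero => rfl
    | succ N ih => rw [← hstep, ih]
  have ht := hf.sub hg
  simp only [hconst, sub_self] at ht
  have h0 := tendsto_nhds_unique tendsto_const_nhds ht
  funext N
  exact sub_eq_zero.1 ((hconst N).trans h0)

/-- The fundamental solution of `Δᵐ` vanishing at infinity. -/
def greenFunction (q : ℝ) (m N : ℕ) : ℂ :=
  (-1 : ℂ) ^ m / (2 * (Real.pi : ℂ) * Complex.I) * (1 - (q : ℂ) ^ 2) ^ (2 * m) *
    greenSeries q m N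

lemma tendsto_greenFunction (hq : q ∈ Set.Ioo (0 : ℝ) 1) (m : ℕ) :
    Tendsto (greenFunction q m) atTop (𝓝 0) := by
  have h := (tendsto_greenSeries (norm_ofReal_lt_one hq) m).const_mul
    ((-1 : ℂ) ^ m / (2 * (Real.pi : ℂ) * Complex.I) * (1 - (q : ℂ) ^ 2) ^ (2 * m))
  rwa [mul_zero] at h

lemma greenFunction_zero (hq : q ∈ Set.Ioo (0 : ℝ) 1) : greenFunction q 0 = fZero := by
  funext N
  rw [greenFunction, greenSeries_zero_left (norm_ofReal_lt_one hq)]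
  have := Complex.two_pi_I_ne_zero
  field_simp
  simp

lemma deltaQ_greenFunction_succ (hq : q ∈ Set.Ioo (0 : ℝ) 1) (m : ℕ) :
    DeltaQ q (greenFunction q (m + 1)) = greenFunction q m := by
  funext N
  have h0 : (q : ℂ) ≠ 0 := by exact_mod_cast hq.1.ne'
  have h1 : (1 - (q : ℂ) ^ 2) ≠ 0 := by
    have : 1 - q ^ 2 ≠ 0 := by nlinarith [hq.1, hq.2]
    exact_mod_cast this
  have h := greenSeries_recurrence (norm_ofReal_lt_one hq) h0 m N
  rw [deltaQ_eq hq]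
  simp only [greenFunction]
  rw [show (1 - (q : ℂ) ^ 2) ^ (2 * (m + 1)) = (1 - (q : ℂ) ^ 2) ^ (2 * m) *
    (1 - (q : ℂ) ^ 2) ^ 2 by ring]
  have h2 : ((1 - (q : ℂ) ^ 2) ^ 2)⁻¹ * (1 - (q : ℂ) ^ 2) ^ 2 = 1 :=
    inv_mul_cancel₀ (pow_ne_zero 2 h1)
  generalize ((1 - (q : ℂ) ^ 2) ^ 2)⁻¹ = d at *
  linear_combination (-1 : ℂ) ^ (m + 1) / (2 * (Real.pi : ℂ) * Complex.I) *
    (1 - (q : ℂ) ^ 2) ^ (2 * m) * (d * (1 - (q : ℂ) ^ 2) ^ 2 * h - greenSeries q m N * h2)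

lemma eq_greenFunction_of_iterate_deltaQ (hq : q ∈ Set.Ioo (0 : ℝ) 1) (m : ℕ) {g : ℕ → ℂ}
    (hg : Tendsto g atTop (𝓝 0)) (h : (DeltaQ q)^[m] g = fZero) : g = greenFunction q m := by
  induction m generalizing g with
  | zero => rw [greenFunction_zero hq]; exact h
  | succ m ih =>
    refine deltaQ_injOn hq hg (tendsto_greenFunction hq _) ?_
    rw [deltaQ_greenFunction_succ hq]
    exact ih (tendsto_deltaQ hq hg) (by rwa [Function.iterate_succ_apply] at h)

lemma tendsto_zero_of_summable_norm_sq_mul_zpow (hq : q ∈ Set.Ioo (0 : ℝ) 1) {g : ℕ → ℂ}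
    (hg : Summable (fun N : ℕ => ‖g N‖ ^ 2 * q ^ (-(2 * (N : ℤ))))) :
    Tendsto g atTop (𝓝 0) := by
  have h : Tendsto (fun N => ‖g N‖ ^ 2) atTop (𝓝 0) := by
    refine squeeze_zero (fun N => by positivity) (fun N => ?_) hg.tendsto_atTop_zero
    refine le_mul_of_one_le_right (by positivity) ?_
    exact one_le_zpow_of_nonpos₀ hq.1 hq.2.le (by lia)
  have h2 := h.sqrt
  simp only [Real.sqrt_sq (norm_nonneg _), Real.sqrt_zero] at h2
  exact tendsto_zero_iff_norm_tendsto_zero.2 h2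

lemma greenTerm_eq {c : ℂ} (hc : ‖c‖ < 1) {m : ℕ} (hm : 1 ≤ m) (N k : ℕ) :
    greenTerm c m N k = qPochInf (c ^ 2) (c ^ 2) * c ^ N *
      (c ^ (2 * N * k + 2 * k) / qPoch (c ^ 2) (c ^ 2) k *
          (∮ τ in C(0, 1),
            τ ^ (N + m - 1) * (1 - τ ^ 2) * qPochInf (c ^ (2 * k + 2) * τ ^ 2) (c ^ 2) /
              ((τ - c) ^ m * (1 - c * τ) ^ m *
                (qPochInf (c ^ (2 * k + 1) * τ) (c ^ 2)) ^ 2))) := by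
  have hP := qPochInf_eq_qPoch_mul (norm_sq_lt_one hc) (c ^ 2) k
  have hne := left_ne_zero_of_mul (hP ▸ qPochInf_ne_zero (norm_sq_lt_one hc) (norm_sq_lt_one hc))
  have hI : (∮ τ in C(0, 1), greenIntegrand c m N ((c ^ 2) ^ k) τ) =
      ∮ τ in C(0, 1), c ^ N * qPochInf (c ^ 2 * (c ^ 2) ^ k) (c ^ 2) *
        (τ ^ (N + m - 1) * (1 - τ ^ 2) * qPochInf (c ^ (2 * k + 2) * τ ^ 2) (c ^ 2) /
              ((τ - c) ^ m * (1 - c * τ) ^ m *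
                (qPochInf (c ^ (2 * k + 1) * τ) (c ^ 2)) ^ 2)) := by
    refine circleIntegral.integral_congr zero_le_one fun τ hτ => ?_
    have h3 := ne_zero_of_mem_unit_circle hτ
    obtain ⟨m, rfl⟩ := Nat.exists_eq_add_of_le' hm
    simp only [greenIntegrand, greenWeight, greenKernel]
    rw [show c ^ 2 * (c ^ 2) ^ k * τ ^ 2 = c ^ (2 * k + 2) * τ ^ 2 by ring,
      show c * (c ^ 2) ^ k * τ = c ^ (2 * k + 1) * τ by ring,
      show N + (m + 1) - 1 = N + m by lia, div_pow, mul_pow, mul_pow, pow_succ τ m, pow_add τ N m]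
    have htt : τ⁻¹ * τ = 1 := inv_mul_cancel₀ h3
    simp only [div_eq_mul_inv, mul_inv]
    generalize ((τ - c) ^ (m + 1))⁻¹ = u
    generalize ((1 - c * τ) ^ (m + 1))⁻¹ = v
    linear_combination c ^ N * τ ^ N * (1 - τ ^ 2) * τ ^ m * u * v *
      qPochInf (c ^ 2 * (c ^ 2) ^ k) (c ^ 2) * qPochInf (c ^ (2 * k + 2) * τ ^ 2) (c ^ 2) *
      (qPochInf (c ^ (2 * k + 1) * τ) (c ^ 2) ^ 2)⁻¹ * htt
  rw [greenTerm, hI, circleIntegral.integral_const_mul, hP]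
  field_simp
  ring_nf

end DeltaQ

/-- Lemma 3.4 of the paper: if `g ∈ L²(dν)q⁰` satisfies `Δ^m g = f₀`
(`m ≥ 1`), then `g(q^{2N})` is given by an explicit series of contour integrals over the
unit circle, traversed counterclockwise. -/
theorem green_function_contour_formula (q : ℝ) (hq : q ∈ Set.Ioo (0 : ℝ) 1)
    (m : ℕ) (hm : 1 ≤ m) (g : ℕ → ℂ)
    (hg : Summable (fun N : ℕ => ‖g N‖ ^ 2 * q ^ (-(2 * (N : ℤ)))))
    (hgm : (DeltaQ q)^[m] g = fZero) :
    ∀ N : ℕ,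
      g N = (-1 : ℂ) ^ m / (2 * (Real.pi : ℂ) * Complex.I) * (1 - (q : ℂ) ^ 2) ^ (2 * m) *
        qPochInf ((q : ℂ) ^ 2) ((q : ℂ) ^ 2) * (q : ℂ) ^ N *
        ∑' k : ℕ, (q : ℂ) ^ (2 * N * k + 2 * k) / qPoch ((q : ℂ) ^ 2) ((q : ℂ) ^ 2) k *
          (∮ τ in C(0, 1),
            τ ^ (N + m - 1) * (1 - τ ^ 2) * qPochInf ((q : ℂ) ^ (2 * k + 2) * τ ^ 2) ((q : ℂ) ^ 2) /
              ((τ - (q : ℂ)) ^ m * (1 - (q : ℂ) * τ) ^ m *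
                (qPochInf ((q : ℂ) ^ (2 * k + 1) * τ) ((q : ℂ) ^ 2)) ^ 2)) := by
  intro N
  rw [eq_greenFunction_of_iterate_deltaQ hq m (tendsto_zero_of_summable_norm_sq_mul_zpow hq hg) hgm]
  simp only [greenFunction, greenSeries, greenTerm_eq (norm_ofReal_lt_one hq) hm]
  rw [tsum_mul_left]
  simp only [mul_assoc]

end
end
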